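/- arXiv:2207.08725 — 2 statements merged into one kernel-verified Lean document; each statement's English description precedes it below -/
import Mathlib

section
/- Let α ∈ [1,2] and let a ∈ L^∞(R²) with ‖a‖_{L^∞} ≤ 1. Then there exist K₀ ≥ 1 and C = C(ξ₀) > 0 such that for all real-valued u₁, u₂ ∈ L²(R×T) and all dyadic numbers N₁, N₂, L₁, L₂ ≥ 1 with N₁∨N₂ ≥ K₀(N₁∧N₂): ‖Λ_a(Q_{≤L₁}P_{N₁}u₁, Q_{≤L₂}P_{N₂}u₂)‖_{L²(R×T)} ≤ C (L₁∧L₂)^{1/2} min( (L₁∨L₂)^{1/2}/(N₁∨N₂)^{α/2} + 1, (N₁∧N₂)^{1/2} ) ‖Q_{≤L₁}P_{N₁}u₁‖_{L²(R×T)} ‖Q_{≤L₂}P_{N₂}u₂‖_{L²(R×T)}. -/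
open MeasureTheory Complex Real Set Filter
open scoped ENNReal NNReal

noncomputable section

/-- **Hypothesis 1**: `p` is the symbol of the dispersive operator `L_{α+1}`
(the Fourier multiplier by `-i p(ξ)`); `p` is an odd real-valued function of class `C¹`
on `ℝ` and `C²` away from the origin, and for `ξ ≥ ξ₀` the first and second derivatives
of `p` are comparable to `ξ^α` and `ξ^(α-1)` respectively. -/
structure Hyp1 (α ξ₀ c C : ℝ) (p : ℝ → ℝ) : Prop where
  xi0_pos : 0 < ξ₀
  c_pos : 0 < c
  c_le_C : c ≤ C
  smooth1 : ContDiff ℝ 1 p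
  smooth2 : ∀ x : ℝ, x ≠ 0 → ContDiffAt ℝ 2 p x
  odd : ∀ x : ℝ, p (-x) = -p x
  deriv_lb : ∀ ξ : ℝ, ξ₀ ≤ ξ → c * ξ ^ α ≤ deriv p ξ
  deriv_ub : ∀ ξ : ℝ, ξ₀ ≤ ξ → deriv p ξ ≤ C * ξ ^ α
  deriv2_lb : ∀ ξ : ℝ, ξ₀ ≤ ξ → c * ξ ^ (α - 1) ≤ deriv (deriv p) ξ
  deriv2_ub : ∀ ξ : ℝ, ξ₀ ≤ ξ → deriv (deriv p) ξ ≤ C * ξ ^ (α - 1)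

/-- The fixed smooth even cutoff function `χ`: `0 ≤ χ ≤ 1`, `χ ≡ 1` on `[-1,1]`,
`supp χ ⊆ [-2,2]`. -/
structure CutoffFun (χ : ℝ → ℝ) : Prop where
  smooth : ContDiff ℝ (⊤ : ℕ∞) χ
  even : ∀ x : ℝ, χ (-x) = χ x
  nonneg : ∀ x : ℝ, 0 ≤ χ x
  le_one : ∀ x : ℝ, χ x ≤ 1
  eq_one : ∀ x ∈ Set.Icc (-1 : ℝ) 1, χ x = 1
  compact_supp : ∀ x : ℝ, χ x ≠ 0 → x ∈ Set.Icc (-2 : ℝ) 2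

/-- The Littlewood–Paley symbol `φ_N`: for a dyadic `N ≥ 1`, `φ_N(ξ) = χ(ξ/N) - χ(2ξ/N)`,
and `φ_0(ξ) = χ(2ξ)`. -/
def lpSymb (χ : ℝ → ℝ) (N ξ : ℝ) : ℝ :=
  if N = 0 then χ (2 * ξ) else χ (ξ / N) - χ (2 * ξ / N)

/-- The Littlewood–Paley projector `P_N`, acting on the (spatial) Fourier coefficients
of a function on the torus. -/
def PN (χ : ℝ → ℝ) (N : ℝ) (u : ℤ → ℂ) : ℤ → ℂ := fun ξ => (lpSymb χ N ξ : ℂ) * u ξ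

/-- Square of the `L²(𝕋)` norm, computed on Fourier coefficients (Parseval). -/
def l2sq (v : ℤ → ℂ) : ℝ := ∑' ξ : ℤ, ‖v ξ‖ ^ 2

/-- `L²(S × 𝕋)` norm of a space-time function given by its spatial Fourier
coefficients `U t ξ`, `S ⊆ ℝ` a set of times. -/
def L2normOn (S : Set ℝ) (U : ℝ → ℤ → ℂ) : ℝ := (∫ t in S, l2sq (U t)) ^ ((1:ℝ)/2)

/-- `L²(ℝ × 𝕋)` norm. -/
def L2full (U : ℝ → ℤ → ℂ) : ℝ := (∫ t : ℝ, l2sq (U t)) ^ ((1:ℝ)/2)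

/-- `L^∞(]0,T[; L²(𝕋))` norm. -/
def LinfL2 (T : ℝ) (U : ℝ → ℤ → ℂ) : ℝ := ⨆ t : Set.Ioo (0:ℝ) T, (l2sq (U t)) ^ ((1:ℝ)/2)

/-- Membership in `L²(ℝ × 𝕋)`. -/
def MemL2 (U : ℝ → ℤ → ℂ) : Prop :=
  (∀ t : ℝ, Summable fun ξ : ℤ => ‖U t ξ‖ ^ 2) ∧
  (∀ ξ : ℤ, Measurable fun t : ℝ => U t ξ) ∧
  Integrable (fun t : ℝ => l2sq (U t))

/-- Membership in `L^∞(]0,T[; L²(𝕋))`, together with measurability of the coefficients. -/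
def MemLinfL2 (T : ℝ) (U : ℝ → ℤ → ℂ) : Prop :=
  (∀ t ∈ Set.Ioo (0:ℝ) T, Summable fun ξ : ℤ => ‖U t ξ‖ ^ 2) ∧
  (∀ ξ : ℤ, Measurable fun t : ℝ => U t ξ) ∧
  (∃ M : ℝ, ∀ t ∈ Set.Ioo (0:ℝ) T, l2sq (U t) ≤ M)

/-- Continuity with values in `L²(𝕋)` on `[0,T]`. -/
def ContL2On (T : ℝ) (U : ℝ → ℤ → ℂ) : Prop :=
  ∀ t₀ ∈ Set.Icc (0:ℝ) T,
    Filter.Tendsto (fun t => l2sq (fun ξ => U t ξ - U t₀ ξ))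
      (nhdsWithin t₀ (Set.Icc (0:ℝ) T)) (nhds 0)

/-- Time Fourier transform (with the convention `∫ e^{-iτt} g(t) dt`). -/
def FT (g : ℝ → ℂ) (τ : ℝ) : ℂ := ∫ t : ℝ, Complex.exp (-(Complex.I * τ * t)) * g t

/-- Inverse time Fourier transform. -/
def IFT (g : ℝ → ℂ) (t : ℝ) : ℂ :=
  (2 * Real.pi)⁻¹ • ∫ τ : ℝ, Complex.exp (Complex.I * τ * t) * g τ

/-- The modulation projector `Q_L`, a space-time Fourier multiplier with symbol
`ψ_L(τ,ξ) = φ_L(τ - p(ξ))` (acting on spatial Fourier coefficients `U t ξ`). -/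
def QL (χ p : ℝ → ℝ) (L : ℝ) (U : ℝ → ℤ → ℂ) : ℝ → ℤ → ℂ := fun t ξ =>
  IFT (fun τ => (lpSymb χ L (τ - p ξ) : ℂ) * FT (fun s => U s ξ) τ) t

/-- `Q_{≤ 2^l} = Q_0 + ∑_{j ≤ l} Q_{2^j}`. -/
def Qle (χ p : ℝ → ℝ) (l : ℕ) (U : ℝ → ℤ → ℂ) : ℝ → ℤ → ℂ := fun t ξ =>
  QL χ p 0 U t ξ + ∑ j ∈ Finset.range (l + 1), QL χ p ((2:ℝ) ^ j) U t ξ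

/-- The `X^{0,1/2,1}` (Besov–Bourgain) norm:
`‖u‖ = ∑_L max(L,1)^{1/2} ‖Q_L u‖_{L²(ℝ×𝕋)}`, `L` running over `{0} ∪ 2^ℕ`. -/
def Xhalf (χ p : ℝ → ℝ) (U : ℝ → ℤ → ℂ) : ℝ :=
  L2full (QL χ p 0 U) + ∑' l : ℕ, ((2:ℝ) ^ l) ^ ((1:ℝ)/2) * L2full (QL χ p ((2:ℝ) ^ l) U)

/-- Membership in `X^{0,1/2,1}`. -/
def MemX (χ p : ℝ → ℝ) (U : ℝ → ℤ → ℂ) : Prop :=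
  (∀ ξ : ℤ, Measurable fun t : ℝ => U t ξ) ∧
  Integrable (fun t : ℝ => l2sq (QL χ p 0 U t)) ∧
  (∀ l : ℕ, Integrable fun t : ℝ => l2sq (QL χ p ((2:ℝ) ^ l) U t)) ∧
  Summable (fun l : ℕ => ((2:ℝ) ^ l) ^ ((1:ℝ)/2) * L2full (QL χ p ((2:ℝ) ^ l) U))

/-- The bilinear operator `Λ_a`:
`(Λ_a(u,v))^(ξ) = ∑_{ξ₁+ξ₂=ξ} a(ξ₁,ξ₂) û(ξ₁) v̂(ξ₂)`. -/
def Lam (a : ℝ → ℝ → ℂ) (u v : ℤ → ℂ) : ℤ → ℂ := fun ξ =>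
  ∑' ξ₁ : ℤ, a ξ₁ ((ξ : ℝ) - ξ₁) * u ξ₁ * v (ξ - ξ₁)

/-- `u` solves `∂_t u + L_{α+1} u + ∂_x f = 0` on `]0,T[ × 𝕋` (in the distributional
sense), formulated equivalently through the Duhamel formula on each spatial Fourier
mode; `U` and `F` are the spatial Fourier coefficients of `u` and `f`. -/
def Solves (p : ℝ → ℝ) (T : ℝ) (U F : ℝ → ℤ → ℂ) : Prop :=
  ∀ ξ : ℤ, ∀ t ∈ Set.Icc (0:ℝ) T,
    U t ξ = Complex.exp (Complex.I * (p ξ) * t) * U 0 ξ -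
      ∫ s in (0:ℝ)..t,
        Complex.exp (Complex.I * (p ξ) * (t - s)) * (Complex.I * (ξ:ℂ)) * F s ξ

/-- Fourier coefficients of the free evolution `e^{-tL_{α+1}} φ`. -/
def freeEvol (p : ℝ → ℝ) (φ : ℤ → ℂ) : ℝ → ℤ → ℂ := fun t ξ =>
  Complex.exp (Complex.I * (p ξ) * t) * φ ξ


open FourierTransform SchwartzMap in
lemma planch {f : ℝ → ℂ} (h1 : Integrable f) (h2 : MemLp f 2) :
    MemLp (𝓕 f) 2 ∧ ∫ x, ‖𝓕 f x‖ ^ 2 = ∫ x, ‖f x‖ ^ 2 := by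
  let F : Lp ℂ 2 (volume : Measure ℝ) := h2.toLp f
  let G : Lp ℂ 2 (volume : Measure ℝ) := 𝓕 F
  have hcont : Continuous (𝓕 f) :=
    VectorFourier.fourierIntegral_continuous Real.continuous_fourierChar
      (by exact continuous_inner) h1
  have hG : (G : ℝ → ℂ) =ᵐ[volume] 𝓕 f := by
    apply ae_eq_of_integral_contDiff_smul_eq
    · exact (Lp.memLp G).locallyIntegrable (by norm_num)
    · exact hcont.locallyIntegrable
    intro g gd gc
    let g' : 𝓢(ℝ, ℂ) := HasCompactSupport.toSchwartzMap (f := fun x => (g x : ℂ))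
      (gc.comp_left (g := fun x : ℝ => (x : ℂ)) (by simp))
      (Complex.ofRealCLM.contDiff.comp gd)
    have hg' : ∀ x, g' x = (g x : ℂ) := fun x => rfl
    have e1 : (𝓕 (Lp.toTemperedDistribution F)) g' = Lp.toTemperedDistribution G g' := by
      rw [MeasureTheory.Lp.fourier_toTemperedDistribution_eq]
    rw [TemperedDistribution.fourier_apply, Lp.toTemperedDistribution_apply,
      Lp.toTemperedDistribution_apply] at e1
    have e2 : ∫ x, (𝓕 g') x • F x = ∫ x, (𝓕 g') x • f x := by
      apply integral_congr_ae
      filter_upwards [h2.coeFn_toLp] with x hx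
      simp only [F, hx]
    have e3 : ∫ x, (𝓕 g') x • f x = ∫ x, g' x • 𝓕 f x := by
      have := VectorFourier.integral_fourierIntegral_smul_eq_flip (μ := (volume : Measure ℝ))
        (ν := (volume : Measure ℝ)) (L := innerₗ ℝ) (f := g') (g := f)
        Real.continuous_fourierChar (by exact continuous_inner) g'.integrable h1
      rw [flip_innerₗ] at this
      exact this
    simp only [hg'] at e1 e3
    simp only [Complex.real_smul]
    rw [e2, e3] at e1
    simpa using e1.symm
  have hm : MemLp (𝓕 f) 2 := (memLp_congr_ae hG).1 (Lp.memLp G)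
  refine ⟨hm, ?_⟩
  have hn : ‖G‖ = ‖F‖ := MeasureTheory.Lp.norm_fourier_eq F
  have key : ∀ H : Lp ℂ 2 (volume : Measure ℝ), ‖H‖ ^ 2 = ∫ x, ‖H x‖ ^ 2 := by
    intro H
    have := L2.inner_def (𝕜 := ℂ) H H
    rw [inner_self_eq_norm_sq_to_K] at this
    simp only [inner_self_eq_norm_sq_to_K] at this
    have h3 : ((‖H‖ ^ 2 : ℝ) : ℂ) = ((∫ x, ‖H x‖ ^ 2 : ℝ) : ℂ) := by
      rw [← integral_complex_ofReal]; push_cast; exact_mod_cast this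
    exact_mod_cast h3
  have k1 := key G
  have k2 := key F
  rw [hn, k2] at k1
  calc ∫ x, ‖𝓕 f x‖ ^ 2 = ∫ x, ‖G x‖ ^ 2 := by
        apply integral_congr_ae
        filter_upwards [hG] with x hx
        rw [hx]
    _ = ∫ x, ‖F x‖ ^ 2 := k1.symm
    _ = _ := by
        apply integral_congr_ae
        filter_upwards [h2.coeFn_toLp] with x hx
        simp only [F, hx]

open FourierTransform in
lemma IFT_eq (f : ℝ → ℂ) (t : ℝ) :
    IFT f t = ((2 * Real.pi)⁻¹ : ℝ) • 𝓕 f (t * (-(2 * Real.pi)⁻¹)) := by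
  unfold IFT
  congr 1
  rw [Real.fourier_real_eq_integral_exp_smul]
  congr 1
  ext τ
  rw [smul_eq_mul]
  congr 2
  push_cast
  have : (Real.pi : ℂ) ≠ 0 := by exact_mod_cast Real.pi_ne_zero
  field_simp

lemma IFT_continuous {f : ℝ → ℂ} (h1 : Integrable f) : Continuous (IFT f) := by
  have hcont : Continuous (FourierTransform.fourier f) :=
    VectorFourier.fourierIntegral_continuous Real.continuous_fourierChar
      (by exact continuous_inner) h1
  have : IFT f = fun t => ((2 * Real.pi)⁻¹ : ℝ) •
      FourierTransform.fourier f (t * (-(2 * Real.pi)⁻¹)) := by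
    ext t; exact IFT_eq f t
  rw [this]
  fun_prop

/-- Plancherel for `IFT`. -/
lemma IFT_planch {f : ℝ → ℂ} (h1 : Integrable f) (h2 : MemLp f 2) :
    Integrable (fun t => ‖IFT f t‖ ^ 2) ∧
      ∫ t, ‖IFT f t‖ ^ 2 = (2 * Real.pi)⁻¹ * ∫ x, ‖f x‖ ^ 2 := by
  obtain ⟨hm, he⟩ := planch h1 h2
  have hpi := Real.pi_pos
  have e : (fun t => ‖IFT f t‖ ^ 2) = fun t => ((2 * Real.pi)⁻¹) ^ 2 *
      (fun s => ‖FourierTransform.fourier f s‖ ^ 2) (t * (-(2 * Real.pi)⁻¹)) := by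
    ext t
    rw [IFT_eq, norm_smul, mul_pow, Real.norm_of_nonneg (by positivity)]
  have hi : Integrable (fun s => ‖FourierTransform.fourier f s‖ ^ 2) := by
    have := hm.integrable_norm_rpow (by norm_num) (by norm_num)
    simpa using this
  rw [e]
  constructor
  · exact (hi.comp_mul_right' (by simp [hpi.ne'])).const_mul _
  · rw [integral_const_mul, Measure.integral_comp_mul_right (fun s => ‖FourierTransform.fourier f s‖ ^ 2), he, smul_eq_mul, ← mul_assoc]
    congr 1
    rw [inv_neg, inv_inv, abs_neg, abs_of_pos (by positivity)]
    field_simp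

open Convolution in
lemma IFT_mul {f g : ℝ → ℂ} (hf : Integrable f) (hg : Integrable g) (t : ℝ) :
    IFT f t * IFT g t = (2 * Real.pi)⁻¹ * IFT (f ⋆[ContinuousLinearMap.mul ℂ ℂ] g) t := by
  rw [IFT_eq, IFT_eq, IFT_eq, Real.fourier_mul_convolution_eq hf hg]
  simp only [Complex.real_smul]
  push_cast
  ring


lemma cs_int {k : ℝ → ℂ} (hk : Continuous k) (hs : HasCompactSupport k) {x m : ℝ} (hm : 0 < m)
    (h0 : ∀ s, k s ≠ 0 → s ∈ Set.Icc x (x + m)) :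
    ‖∫ s, k s‖ ^ 2 ≤ m * ∫ s, ‖k s‖ ^ 2 := by
  have hi1 : Integrable (fun s => ‖k s‖) := (hk.integrable_of_hasCompactSupport hs).norm
  have hi2 : Integrable (fun s => ‖k s‖ ^ 2) := by
    refine Continuous.integrable_of_hasCompactSupport (by fun_prop) ?_
    exact hs.comp_left (g := fun z : ℂ => ‖z‖ ^ 2) (by simp)
  have r1 : ∫ s in Set.Icc x (x + m), ‖k s‖ = ∫ s, ‖k s‖ := by
    apply setIntegral_eq_integral_of_forall_compl_eq_zero
    intro s hs'
    by_contra h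
    exact hs' (h0 s (by simpa using h))
  have r2 : ∫ s in Set.Icc x (x + m), ‖k s‖ ^ 2 = ∫ s, ‖k s‖ ^ 2 := by
    apply setIntegral_eq_integral_of_forall_compl_eq_zero
    intro s hs'
    by_contra h
    exact hs' (h0 s (by simpa using h))
  set A := ∫ s, ‖k s‖ with hA
  set B := ∫ s, ‖k s‖ ^ 2 with hB
  have hq : 0 ≤ ∫ s in Set.Icc x (x + m), (‖k s‖ - A / m) ^ 2 :=
    integral_nonneg fun s => sq_nonneg _
  have e : ∫ s in Set.Icc x (x + m), (‖k s‖ - A / m) ^ 2 = B - 2 * (A / m) * A + m * (A / m) ^ 2 := by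
    have : ∀ s, (‖k s‖ - A / m) ^ 2 = ‖k s‖ ^ 2 - 2 * (A / m) * ‖k s‖ + (A / m) ^ 2 := by
      intro s; ring
    simp only [this]
    rw [integral_add, integral_sub, integral_const_mul, r1, r2]
    · simp [hm.le]
    · exact hi2.integrableOn
    · exact (hi1.integrableOn).const_mul _
    · exact (hi2.integrableOn).sub ((hi1.integrableOn).const_mul _)
    · simp
  rw [e] at hq
  have hA2 : A ^ 2 ≤ m * B := by
    have : B - 2 * (A / m) * A + m * (A / m) ^ 2 = (m * B - A ^ 2) / m := by field_simp; ring
    rw [this] at hq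
    have := (le_div_iff₀ hm).1 hq
    linarith
  calc ‖∫ s, k s‖ ^ 2 ≤ A ^ 2 := by gcongr; exact norm_integral_le_integral_norm _
    _ ≤ _ := hA2

lemma cs_fin {ι : Type*} [DecidableEq ι] (S T : Finset ι) (c : ι → ℂ) {B : ℝ} (hT : (T.card : ℝ) ≤ B)
    (h0 : ∀ i, i ∉ T → c i = 0) : ‖∑ i ∈ S, c i‖ ^ 2 ≤ B * ∑ i ∈ S, ‖c i‖ ^ 2 := by
  have e : ∑ i ∈ S, c i = ∑ i ∈ S ∩ T, c i := by
    symm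
    apply Finset.sum_subset Finset.inter_subset_left
    intro i hi hi'
    apply h0
    intro h; exact hi' (Finset.mem_inter.2 ⟨hi, h⟩)
  rw [e]
  have hB : 0 ≤ B := le_trans (by positivity) hT
  calc ‖∑ i ∈ S ∩ T, c i‖ ^ 2 ≤ (∑ i ∈ S ∩ T, ‖c i‖) ^ 2 := by gcongr; exact norm_sum_le _ _
    _ ≤ ((S ∩ T).card : ℝ) * ∑ i ∈ S ∩ T, ‖c i‖ ^ 2 := sq_sum_le_card_mul_sum_sq
    _ ≤ B * ∑ i ∈ S, ‖c i‖ ^ 2 := by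
      have : ((S ∩ T).card : ℝ) ≤ B :=
        le_trans (by exact_mod_cast Finset.card_le_card Finset.inter_subset_right) hT
      gcongr
      exact Finset.inter_subset_left

lemma cc_int {f : ℝ → ℂ} (hf : Continuous f) (hs : HasCompactSupport f) :
    Integrable f ∧ MemLp f 2 ∧ Integrable (fun t => ‖f t‖ ^ 2) ∧ Continuous (fun t => ‖f t‖ ^ 2) ∧
      HasCompactSupport (fun t => ‖f t‖ ^ 2) := by
  have h2 : HasCompactSupport (fun t => ‖f t‖ ^ 2) :=
    hs.comp_left (g := fun z : ℂ => ‖z‖ ^ 2) (by simp)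
  exact ⟨hf.integrable_of_hasCompactSupport hs, hf.memLp_of_hasCompactSupport hs,
    Continuous.integrable_of_hasCompactSupport (by fun_prop) h2, by fun_prop, h2⟩

lemma IFT_zero (t : ℝ) : IFT (fun _ => 0) t = 0 := by simp [IFT]

lemma l2_eq {h : ℤ → ℝ → ℂ} (hc : ∀ ξ, Continuous (h ξ)) (hs : ∀ ξ, HasCompactSupport (h ξ))
    (S : Finset ℤ) (h0 : ∀ ξ, ξ ∉ S → ∀ τ, h ξ τ = 0) :
    ∫ t, l2sq (fun ξ => IFT (h ξ) t) = (2 * Real.pi)⁻¹ * ∑ ξ ∈ S, ∫ τ, ‖h ξ τ‖ ^ 2 := by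
  have : ∀ t, l2sq (fun ξ => IFT (h ξ) t) = ∑ ξ ∈ S, ‖IFT (h ξ) t‖ ^ 2 := by
    intro t
    unfold l2sq
    apply tsum_eq_sum
    intro ξ hξ
    have : h ξ = fun _ => 0 := funext (h0 ξ hξ)
    simp only [this, IFT_zero]; simp
  simp only [this]
  rw [integral_finsetSum, Finset.mul_sum]
  · refine Finset.sum_congr rfl fun ξ _ => ?_
    obtain ⟨a1, a2, -⟩ := cc_int (hc ξ) (hs ξ)
    exact (IFT_planch a1 a2).2
  · intro ξ _
    obtain ⟨a1, a2, -⟩ := cc_int (hc ξ) (hs ξ)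
    exact (IFT_planch a1 a2).1

lemma IFT_sum (S : Finset ℤ) (b : ℤ → ℂ) (f : ℤ → ℝ → ℂ) (hf : ∀ i, Integrable (f i)) (t : ℝ) :
    IFT (fun τ => ∑ i ∈ S, b i * f i τ) t = ∑ i ∈ S, b i * IFT (f i) t := by
  unfold IFT
  have hi : ∀ i, Integrable (fun τ : ℝ => Complex.exp (Complex.I * τ * t) * f i τ) := by
    intro i
    refine (hf i).bdd_mul (c := 1) (by fun_prop) ?_
    filter_upwards with τ
    have : Complex.I * τ * t = ((τ * t : ℝ) : ℂ) * Complex.I := by push_cast; ring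
    rw [this, Complex.norm_exp_ofReal_mul_I]
  have e : ∀ τ : ℝ, Complex.exp (Complex.I * τ * t) * ∑ i ∈ S, b i * f i τ =
      ∑ i ∈ S, b i * (Complex.exp (Complex.I * τ * t) * f i τ) := by
    intro τ; rw [Finset.mul_sum]; refine Finset.sum_congr rfl fun i _ => by ring
  simp only [e]
  rw [integral_finsetSum _ (fun i _ => (hi i).const_mul _), Finset.smul_sum]
  refine Finset.sum_congr rfl fun i _ => ?_
  rw [integral_const_mul, mul_smul_comm]

open Convolution in
theorem core (h₁ h₂ : ℤ → ℝ → ℂ) (hc₁ : ∀ ξ, Continuous (h₁ ξ)) (hc₂ : ∀ ξ, Continuous (h₂ ξ))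
    (hs₁ : ∀ ξ, HasCompactSupport (h₁ ξ)) (hs₂ : ∀ ξ, HasCompactSupport (h₂ ξ))
    (S₁ S₂ : Finset ℤ) (h0₁ : ∀ ξ, ξ ∉ S₁ → ∀ τ, h₁ ξ τ = 0)
    (h0₂ : ∀ ξ, ξ ∉ S₂ → ∀ τ, h₂ ξ τ = 0)
    (a : ℝ → ℝ → ℂ) (ha : ∀ x y : ℝ, ‖a x y‖ ≤ 1) (m B : ℝ) (hm : 0 < m) (hB0 : 0 ≤ B)
    (hE : ∀ ξ₁ ξ₂ τ, ∃ x, ∀ s, h₁ ξ₁ s * h₂ ξ₂ (τ - s) ≠ 0 → s ∈ Set.Icc x (x + m))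
    (hB : ∀ (ξ : ℤ) (τ : ℝ), ∃ T : Finset ℤ, (T.card : ℝ) ≤ B ∧
      ∀ ξ₁, ξ₁ ∉ T → ∀ s, h₁ ξ₁ s * h₂ (ξ - ξ₁) (τ - s) = 0) :
    ∫ t, l2sq (Lam a (fun ξ => IFT (h₁ ξ) t) (fun ξ => IFT (h₂ ξ) t)) ≤
      m * B * (∫ t, l2sq (fun ξ => IFT (h₁ ξ) t)) * (∫ t, l2sq (fun ξ => IFT (h₂ ξ) t)) := by
  classical
  let S : Finset ℤ := Finset.image₂ (· + ·) S₁ S₂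
  let cv : ℤ → ℤ → ℝ → ℂ := fun ξ ξ₁ => h₁ ξ₁ ⋆[ContinuousLinearMap.mul ℂ ℂ] h₂ (ξ - ξ₁)
  have cvdef : ∀ ξ ξ₁ τ, cv ξ ξ₁ τ = ∫ s, h₁ ξ₁ s * h₂ (ξ - ξ₁) (τ - s) := fun _ _ _ => rfl
  have cvc : ∀ ξ ξ₁, Continuous (cv ξ ξ₁) := fun ξ ξ₁ =>
    (hs₂ _).continuous_convolution_right _ (hc₁ _).locallyIntegrable (hc₂ _)
  have cvs : ∀ ξ ξ₁, HasCompactSupport (cv ξ ξ₁) := fun ξ ξ₁ => (hs₁ _).convolution _ (hs₂ _)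
  have hsum : ∀ (b : ℤ → ℂ) ξ, Continuous (fun τ => ∑ ξ₁ ∈ S₁, b ξ₁ * cv ξ ξ₁ τ) := by
    intro b ξ
    exact continuous_finsetSum _ fun i _ => continuous_const.mul (cvc ξ i)
  let H : ℤ → ℝ → ℂ := fun ξ τ =>
    ∑ ξ₁ ∈ S₁, ((2 * Real.pi : ℂ)⁻¹ * a ξ₁ ((ξ : ℝ) - ξ₁)) * cv ξ ξ₁ τ
  have Hc : ∀ ξ, Continuous (H ξ) := fun ξ => hsum _ ξ
  have Hs : ∀ ξ, HasCompactSupport (H ξ) := by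
    intro ξ
    have : H ξ = ∑ ξ₁ ∈ S₁, fun τ => ((2 * Real.pi : ℂ)⁻¹ * a ξ₁ ((ξ : ℝ) - ξ₁)) * cv ξ ξ₁ τ := by
      ext τ; simp [H]
    rw [this]
    refine Finset.sum_induction _ HasCompactSupport (fun f g => HasCompactSupport.add)
      HasCompactSupport.zero ?_
    intro i _
    exact (cvs ξ i).mul_left
  have H0 : ∀ ξ, ξ ∉ S → ∀ τ, H ξ τ = 0 := by
    intro ξ hξ τ
    apply Finset.sum_eq_zero
    intro ξ₁ h₁m
    have : ξ - ξ₁ ∉ S₂ := by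
      intro h
      exact hξ (Finset.mem_image₂.2 ⟨ξ₁, h₁m, ξ - ξ₁, h, by ring⟩)
    rw [cvdef]
    simp [h0₂ _ this]
  have hLam : ∀ t, Lam a (fun ξ => IFT (h₁ ξ) t) (fun ξ => IFT (h₂ ξ) t) =
      fun ξ => IFT (H ξ) t := by
    intro t
    ext ξ
    unfold Lam
    rw [tsum_eq_sum (s := S₁)]
    · rw [IFT_sum S₁ _ _ (fun i => (cc_int (cvc ξ i) (cvs ξ i)).1)]
      refine Finset.sum_congr rfl fun i _ => ?_
      have := IFT_mul (cc_int (hc₁ i) (hs₁ i)).1 (cc_int (hc₂ (ξ - i)) (hs₂ (ξ - i))).1 t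
      rw [mul_assoc, this]
      push_cast
      ring
    · intro i hi
      have : h₁ i = fun _ => 0 := funext (h0₁ i hi)
      simp only [this, IFT_zero]; simp
  simp only [hLam]
  rw [l2_eq Hc Hs S H0, l2_eq hc₁ hs₁ S₁ h0₁, l2_eq hc₂ hs₂ S₂ h0₂]
  let I₁ : ℤ → ℝ := fun ξ => ∫ τ, ‖h₁ ξ τ‖ ^ 2
  let I₂ : ℤ → ℝ := fun ξ => ∫ τ, ‖h₂ ξ τ‖ ^ 2
  have I₁n : ∀ ξ, 0 ≤ I₁ ξ := fun ξ => integral_nonneg fun _ => sq_nonneg _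
  have I₂n : ∀ ξ, 0 ≤ I₂ ξ := fun ξ => integral_nonneg fun _ => sq_nonneg _
  let cw : ℤ → ℤ → ℝ → ℝ := fun ξ ξ₁ =>
    (fun s => ‖h₁ ξ₁ s‖ ^ 2) ⋆[ContinuousLinearMap.mul ℝ ℝ] (fun s => ‖h₂ (ξ - ξ₁) s‖ ^ 2)
  have cwdef : ∀ ξ ξ₁ τ, cw ξ ξ₁ τ = ∫ s, ‖h₁ ξ₁ s‖ ^ 2 * ‖h₂ (ξ - ξ₁) (τ - s)‖ ^ 2 :=
    fun _ _ _ => rfl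
  have cwi : ∀ ξ ξ₁, Integrable (cw ξ ξ₁) := fun ξ ξ₁ =>
    (cc_int (hc₁ ξ₁) (hs₁ ξ₁)).2.2.1.integrable_convolution _
      (cc_int (hc₂ (ξ - ξ₁)) (hs₂ (ξ - ξ₁))).2.2.1
  have cwint : ∀ ξ ξ₁, ∫ τ, cw ξ ξ₁ τ = I₁ ξ₁ * I₂ (ξ - ξ₁) := fun ξ ξ₁ =>
    integral_convolution _ (cc_int (hc₁ ξ₁) (hs₁ ξ₁)).2.2.1
      (cc_int (hc₂ (ξ - ξ₁)) (hs₂ (ξ - ξ₁))).2.2.1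
  have hpi : 0 < (2 * Real.pi)⁻¹ := by have := Real.pi_pos; positivity
  have key : ∀ ξ τ, ‖H ξ τ‖ ^ 2 ≤ ((2 * Real.pi)⁻¹) ^ 2 * (m * B) * ∑ ξ₁ ∈ S₁, cw ξ ξ₁ τ := by
    intro ξ τ
    obtain ⟨T, hT, hT0⟩ := hB ξ τ
    have s1 := cs_fin S₁ T (fun ξ₁ => ((2 * Real.pi : ℂ)⁻¹ * a ξ₁ ((ξ : ℝ) - ξ₁)) * cv ξ ξ₁ τ) hT
      (by
        intro i hi
        simp only [cvdef, hT0 i hi, integral_zero, mul_zero])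
    have s2 : ∀ ξ₁ ∈ S₁, ‖((2 * Real.pi : ℂ)⁻¹ * a ξ₁ ((ξ : ℝ) - ξ₁)) * cv ξ ξ₁ τ‖ ^ 2 ≤
        ((2 * Real.pi)⁻¹) ^ 2 * m * cw ξ ξ₁ τ := by
      intro ξ₁ _
      obtain ⟨x, hx⟩ := hE ξ₁ (ξ - ξ₁) τ
      have s3 := cs_int (k := fun s => h₁ ξ₁ s * h₂ (ξ - ξ₁) (τ - s))
        ((hc₁ _).mul ((hc₂ _).comp (by fun_prop))) ((hs₁ _).mul_right) hm hx
      rw [← cvdef] at s3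
      simp only [norm_mul, mul_pow] at s3 ⊢
      rw [← cwdef] at s3
      have n1 : ‖(2 * Real.pi : ℂ)⁻¹‖ = (2 * Real.pi)⁻¹ := by
        have : (2 * Real.pi : ℂ)⁻¹ = (((2 * Real.pi)⁻¹ : ℝ) : ℂ) := by push_cast; ring
        rw [this, Complex.norm_real, Real.norm_of_nonneg hpi.le]
      rw [n1]
      have n2 : ‖a ξ₁ ((ξ : ℝ) - ξ₁)‖ ^ 2 ≤ 1 := pow_le_one₀ (norm_nonneg _) (ha _ _)
      calc ((2 * Real.pi)⁻¹) ^ 2 * ‖a ξ₁ ((ξ : ℝ) - ξ₁)‖ ^ 2 * ‖cv ξ ξ₁ τ‖ ^ 2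
          ≤ ((2 * Real.pi)⁻¹) ^ 2 * 1 * (m * cw ξ ξ₁ τ) := by gcongr
        _ = _ := by ring
    calc ‖H ξ τ‖ ^ 2 ≤ _ := s1
      _ ≤ B * ∑ ξ₁ ∈ S₁, ((2 * Real.pi)⁻¹) ^ 2 * m * cw ξ ξ₁ τ := by
        gcongr with i hi
        exact s2 i hi
      _ = _ := by rw [← Finset.mul_sum]; ring
  have key2 : ∀ ξ, ∫ τ, ‖H ξ τ‖ ^ 2 ≤
      ((2 * Real.pi)⁻¹) ^ 2 * (m * B) * ∑ ξ₁ ∈ S₁, I₁ ξ₁ * I₂ (ξ - ξ₁) := by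
    intro ξ
    calc ∫ τ, ‖H ξ τ‖ ^ 2 ≤ ∫ τ, ((2 * Real.pi)⁻¹) ^ 2 * (m * B) * ∑ ξ₁ ∈ S₁, cw ξ ξ₁ τ := by
          apply integral_mono (cc_int (Hc ξ) (Hs ξ)).2.2.1
          · exact (integrable_finsetSum _ fun i _ => cwi ξ i).const_mul _
          · exact key ξ
      _ = _ := by
          rw [integral_const_mul, integral_finsetSum _ fun i _ => cwi ξ i]
          simp only [cwint]
  have key3 : ∑ ξ ∈ S, ∑ ξ₁ ∈ S₁, I₁ ξ₁ * I₂ (ξ - ξ₁) ≤ (∑ ξ ∈ S₁, I₁ ξ) * ∑ ξ ∈ S₂, I₂ ξ := by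
    rw [Finset.sum_comm, Finset.sum_mul]
    refine Finset.sum_le_sum fun ξ₁ _ => ?_
    rw [← Finset.mul_sum]
    refine mul_le_mul_of_nonneg_left ?_ (I₁n _)
    have hz : ∀ ξ, ξ ∉ S₂ → I₂ ξ = 0 := by
      intro ξ hξ; simp [I₂, h0₂ ξ hξ]
    have hsm : Summable I₂ := summable_of_ne_finset_zero (s := S₂) (fun ξ hξ => hz ξ hξ)
    have hsm' : Summable (fun ξ => I₂ (ξ - ξ₁)) := (Equiv.subRight ξ₁).summable_iff.2 hsm
    calc ∑ ξ ∈ S, I₂ (ξ - ξ₁) ≤ ∑' ξ, I₂ (ξ - ξ₁) := hsm'.sum_le_tsum _ fun _ _ => I₂n _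
      _ = ∑' ξ, I₂ ξ := (Equiv.subRight ξ₁).tsum_eq I₂
      _ = ∑ ξ ∈ S₂, I₂ ξ := tsum_eq_sum fun ξ hξ => hz ξ hξ
  have hmB : 0 ≤ m * B := by positivity
  have hl1 : (2 * Real.pi)⁻¹ ≤ 1 := by
    apply inv_le_one_of_one_le₀
    linarith [Real.pi_gt_three]
  have nn : 0 ≤ (∑ ξ ∈ S₁, I₁ ξ) * ∑ ξ ∈ S₂, I₂ ξ :=
    mul_nonneg (Finset.sum_nonneg fun _ _ => I₁n _) (Finset.sum_nonneg fun _ _ => I₂n _)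
  calc (2 * Real.pi)⁻¹ * ∑ ξ ∈ S, ∫ τ, ‖H ξ τ‖ ^ 2
      ≤ (2 * Real.pi)⁻¹ * ∑ ξ ∈ S, ((2 * Real.pi)⁻¹) ^ 2 * (m * B) *
          ∑ ξ₁ ∈ S₁, I₁ ξ₁ * I₂ (ξ - ξ₁) := by gcongr with ξ _; exact key2 ξ
    _ = (2 * Real.pi)⁻¹ * (((2 * Real.pi)⁻¹) ^ 2 * (m * B) *
          ∑ ξ ∈ S, ∑ ξ₁ ∈ S₁, I₁ ξ₁ * I₂ (ξ - ξ₁)) := by rw [← Finset.mul_sum]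
    _ ≤ 1 * (((2 * Real.pi)⁻¹) ^ 2 * (m * B) * ((∑ ξ ∈ S₁, I₁ ξ) * ∑ ξ ∈ S₂, I₂ ξ)) := by
        gcongr
    _ = _ := by simp only [I₁, I₂]; ring


lemma FT_continuous (g : ℝ → ℂ) : Continuous (FT g) := by
  have e : FT g = fun τ => FourierTransform.fourier g (τ * (2 * Real.pi)⁻¹) := by
    ext τ
    rw [Real.fourier_real_eq_integral_exp_smul]
    unfold FT
    congr 1
    ext s
    rw [smul_eq_mul]
    congr 2
    push_cast
    have : (Real.pi : ℂ) ≠ 0 := by exact_mod_cast Real.pi_ne_zero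
    field_simp
  by_cases hg : Integrable g
  · have hcont : Continuous (FourierTransform.fourier g) :=
      VectorFourier.fourierIntegral_continuous Real.continuous_fourierChar
        (by exact continuous_inner) hg
    rw [e]
    fun_prop
  · have : FT g = fun _ => 0 := by
      rw [e]
      ext τ
      apply integral_undef
      intro h
      exact hg ((VectorFourier.fourierIntegral_convergent_iff (L := innerₗ ℝ)
        Real.continuous_fourierChar (by exact continuous_inner) _).1 h)
    rw [this]; fun_prop

/-- The space-time Fourier transform of `Q_{≤ 2^l} u`. -/
def hsym (χ p : ℝ → ℝ) (l : ℕ) (U : ℝ → ℤ → ℂ) (ξ : ℤ) (τ : ℝ) : ℂ :=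
  (χ ((τ - p ξ) / 2 ^ l) : ℂ) * FT (fun s => U s ξ) τ

lemma chi_zero {χ : ℝ → ℝ} (hχ : CutoffFun χ) {x : ℝ} (hx : 2 < |x|) : χ x = 0 := by
  by_contra h
  have := hχ.compact_supp x h
  have h2 := abs_le.2 this
  linarith

lemma chi_cc {χ : ℝ → ℝ} (hχ : CutoffFun χ) (y r : ℝ) (hr : 0 < r) (g : ℝ → ℂ)
    (hg : Continuous g) :
    Continuous (fun τ => (χ ((τ - y) / r) : ℂ) * g τ) ∧
      HasCompactSupport (fun τ => (χ ((τ - y) / r) : ℂ) * g τ) := by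
  have hc := hχ.smooth.continuous
  constructor
  · fun_prop
  · apply HasCompactSupport.intro (isCompact_Icc (a := y - 2 * r) (b := y + 2 * r))
    intro τ hτ
    have : 2 < |(τ - y) / r| := by
      rw [abs_div, abs_of_pos hr, lt_div_iff₀ hr]
      by_contra h
      rw [not_lt, abs_le] at h
      exact hτ ⟨by linarith, by linarith⟩
    simp [chi_zero hχ this]

lemma IFT_add {f g : ℝ → ℂ} (hf : Integrable f) (hg : Integrable g) (t : ℝ) :
    IFT f t + IFT g t = IFT (fun τ => f τ + g τ) t := by
  unfold IFT
  have hi : ∀ f : ℝ → ℂ, Integrable f →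
      Integrable (fun τ : ℝ => Complex.exp (Complex.I * τ * t) * f τ) := by
    intro f hf
    refine hf.bdd_mul (c := 1) (by fun_prop) ?_
    filter_upwards with τ
    have : Complex.I * τ * t = ((τ * t : ℝ) : ℂ) * Complex.I := by push_cast; ring
    rw [this, Complex.norm_exp_ofReal_mul_I]
  rw [← smul_add, ← integral_add (hi f hf) (hi g hg)]
  simp only [mul_add]

lemma hsym_cc {χ : ℝ → ℝ} (hχ : CutoffFun χ) (p : ℝ → ℝ) (l : ℕ) (U : ℝ → ℤ → ℂ) (ξ : ℤ) :
    Continuous (hsym χ p l U ξ) ∧ HasCompactSupport (hsym χ p l U ξ) :=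
  chi_cc hχ _ _ (by positivity) _ (FT_continuous _)

lemma Qle_eq {χ : ℝ → ℝ} (hχ : CutoffFun χ) (p : ℝ → ℝ) (l : ℕ) (U : ℝ → ℤ → ℂ) (t : ℝ) :
    Qle χ p l U t = fun ξ => IFT (hsym χ p l U ξ) t := by
  ext ξ
  have hQ : ∀ j : ℕ, Integrable
      (fun τ => (lpSymb χ ((2:ℝ) ^ j) (τ - p ξ) : ℂ) * FT (fun s => U s ξ) τ) := by
    intro j
    have h1 := chi_cc hχ (p ξ) ((2:ℝ) ^ j) (by positivity) _ (FT_continuous (fun s => U s ξ))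
    have h2 := chi_cc hχ (p ξ) ((2:ℝ) ^ j / 2) (by positivity) _ (FT_continuous (fun s => U s ξ))
    have := (cc_int h1.1 h1.2).1.sub (cc_int h2.1 h2.2).1
    refine this.congr ?_
    filter_upwards with τ
    have h3 : (τ - p ξ) / ((2:ℝ) ^ j / 2) = 2 * (τ - p ξ) / 2 ^ j := by field_simp
    simp only [Pi.sub_apply, lpSymb, h3]
    rw [if_neg (by positivity)]
    push_cast
    ring
  have hQ0 : Integrable (fun τ => (lpSymb χ 0 (τ - p ξ) : ℂ) * FT (fun s => U s ξ) τ) := by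
    have h2 := chi_cc hχ (p ξ) (1 / 2) (by positivity) _ (FT_continuous (fun s => U s ξ))
    refine (cc_int h2.1 h2.2).1.congr ?_
    filter_upwards with τ
    have h3 : (τ - p ξ) / ((1:ℝ) / 2) = 2 * (τ - p ξ) := by field_simp
    simp only [lpSymb, h3, if_true]
  induction l with
  | zero =>
    simp only [Qle, zero_add, Finset.sum_range_one, QL]
    rw [IFT_add hQ0 (hQ 0)]
    congr 1
    ext τ
    simp [hsym, lpSymb]
    ring
  | succ l ih =>
    have : Qle χ p (l + 1) U t ξ = Qle χ p l U t ξ + QL χ p ((2:ℝ) ^ (l + 1)) U t ξ := by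
      simp only [Qle]
      rw [Finset.sum_range_succ _ (l + 1)]
      ring
    rw [this, ih]
    simp only [QL]
    have h1 := hsym_cc hχ p l U ξ
    rw [IFT_add (cc_int h1.1 h1.2).1 (hQ (l + 1))]
    congr 1
    ext τ
    have h3 : 2 * (τ - p ξ) / 2 ^ (l + 1) = (τ - p ξ) / 2 ^ l := by
      rw [pow_succ]; field_simp
    simp only [hsym, lpSymb, h3]
    rw [if_neg (by positivity)]
    push_cast
    ring

lemma lpSymb_supp {χ : ℝ → ℝ} (hχ : CutoffFun χ) {N x : ℝ} (hN : 0 < N) (h : lpSymb χ N x ≠ 0) :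
    N / 2 ≤ |x| ∧ |x| ≤ 2 * N := by
  unfold lpSymb at h
  rw [if_neg hN.ne'] at h
  constructor
  · by_contra hx
    rw [not_le] at hx
    apply h
    have hx' := abs_lt.1 hx
    rw [hχ.eq_one, hχ.eq_one, sub_self]
    · constructor
      · rw [le_div_iff₀ hN]; linarith
      · rw [div_le_iff₀ hN]; linarith
    · constructor
      · rw [le_div_iff₀ hN]; linarith
      · rw [div_le_iff₀ hN]; linarith
  · by_contra hx
    rw [not_le] at hx
    apply h
    rw [chi_zero hχ, chi_zero hχ, sub_self]
    · rw [abs_div, abs_mul, abs_of_pos hN, lt_div_iff₀ hN, abs_of_pos (by norm_num : (0:ℝ) < 2)]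
      nlinarith
    · rw [abs_div, abs_of_pos hN, lt_div_iff₀ hN]; linarith

lemma hsym_supp {χ : ℝ → ℝ} (hχ : CutoffFun χ) (p : ℝ → ℝ) (l n : ℕ) (U : ℝ → ℤ → ℂ)
    (ξ : ℤ) (τ : ℝ) (h : hsym χ p l (fun s => PN χ ((2:ℝ) ^ n) (U s)) ξ τ ≠ 0) :
    |τ - p ξ| ≤ 2 * 2 ^ l ∧ (2:ℝ) ^ n / 2 ≤ |(ξ:ℝ)| ∧ |(ξ:ℝ)| ≤ 2 * 2 ^ n := by
  unfold hsym at h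
  obtain ⟨h1, h2⟩ := mul_ne_zero_iff.1 h
  constructor
  · by_contra hx
    rw [not_le] at hx
    apply h1
    rw [chi_zero hχ]
    · simp
    · rw [abs_div, abs_of_pos (by positivity : (0:ℝ) < 2 ^ l), lt_div_iff₀ (by positivity)]
      exact hx
  · apply lpSymb_supp hχ (by positivity)
    intro h3
    apply h2
    simp [FT, PN, h3]

lemma hsym_fin {χ : ℝ → ℝ} (hχ : CutoffFun χ) (p : ℝ → ℝ) (l n : ℕ) (U : ℝ → ℤ → ℂ)
    (ξ : ℤ) (hξ : ξ ∉ Finset.Icc (-(2 * 2 ^ n) : ℤ) (2 * 2 ^ n)) (τ : ℝ) :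
    hsym χ p l (fun s => PN χ ((2:ℝ) ^ n) (U s)) ξ τ = 0 := by
  by_contra h
  have := (hsym_supp hχ p l n U ξ τ h).2.2
  apply hξ
  rw [Finset.mem_Icc, ← abs_le]
  exact_mod_cast this


lemma card_diam (T : Finset ℤ) (D : ℝ) (hD : 0 ≤ D)
    (h : ∀ x ∈ T, ∀ y ∈ T, x < y → (y : ℝ) - x ≤ D) : (T.card : ℝ) ≤ D + 1 := by
  rcases T.eq_empty_or_nonempty with rfl | hT
  · simp; linarith
  · have hsub : T ⊆ Finset.Icc (T.min' hT) (T.max' hT) := fun x hx =>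
      Finset.mem_Icc.2 ⟨T.min'_le x hx, T.le_max' x hx⟩
    have h1 := Finset.card_le_card hsub
    rw [Int.card_Icc] at h1
    have hle : T.min' hT ≤ T.max' hT := T.min'_le _ (T.max'_mem hT)
    have h2 : (T.card : ℤ) ≤ T.max' hT + 1 - T.min' hT := by omega
    have h3 : (T.card : ℝ) ≤ (T.max' hT : ℝ) + 1 - T.min' hT := by exact_mod_cast h2
    rcases hle.eq_or_lt with he | hl
    · rw [he] at h3; linarith
    · have := h _ (T.min'_mem hT) _ (T.max'_mem hT) hl
      linarith

lemma deriv_even {p : ℝ → ℝ} (odd : ∀ x : ℝ, p (-x) = -p x) (x : ℝ) : deriv p (-x) = deriv p x := by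
  have h : (fun y => p (-y)) = fun y => - p y := funext odd
  have h1 : deriv (fun y => p (-y)) x = - deriv p (-x) := deriv_comp_neg p x
  rw [h, deriv.fun_neg] at h1
  linarith

lemma deriv_abs_odd {p : ℝ → ℝ} (odd : ∀ x : ℝ, p (-x) = -p x) (x : ℝ) : deriv p |x| = deriv p x := by
  rcases abs_choice x with h | h <;> rw [h]
  exact deriv_even odd x

lemma slope_bound {α ξ₀ c C : ℝ} (hα : α ∈ Set.Icc (1:ℝ) 2) {p : ℝ → ℝ} (hp : Hyp1 α ξ₀ c C p) :
    ∃ K₀ : ℝ, 1 ≤ K₀ ∧ ∀ N₁ N₂ : ℝ, 1 ≤ N₂ → K₀ * N₂ ≤ N₁ → ∀ z w : ℝ, N₁ / 2 ≤ |z| →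
      |w| ≤ 2 * N₂ → c / 8 * N₁ ^ α ≤ deriv p z - deriv p w := by
  have hcont : Continuous (deriv p) := hp.smooth1.continuous_deriv le_rfl
  obtain ⟨M, hM⟩ := (isCompact_Icc (a := -ξ₀) (b := ξ₀)).exists_bound_of_continuousOn
    hcont.continuousOn
  have hc := hp.c_pos
  have hC : 0 < C := hc.trans_le hp.c_le_C
  have hα0 : 0 ≤ α := by linarith [hα.1]
  set K₀ := max (max 4 (2 * ξ₀)) (max (8 * C / c) (4 * M / c)) with hK
  have k1 : 4 ≤ K₀ := (le_max_left _ _).trans (le_max_left _ _)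
  have k2 : 2 * ξ₀ ≤ K₀ := (le_max_right _ _).trans (le_max_left _ _)
  have k3 : 8 * C / c ≤ K₀ := (le_max_left _ _).trans (le_max_right _ _)
  have k4 : 4 * M / c ≤ K₀ := (le_max_right _ _).trans (le_max_right _ _)
  refine ⟨K₀, by linarith, ?_⟩
  intro N₁ N₂ hN₂ hN z w hz hw
  have hKN : K₀ ≤ N₁ := by nlinarith
  have hN₁ : 0 < N₁ := by linarith
  set P := (N₁ / 2) ^ α with hP
  have hPpos : 0 < P := by positivity
  have hz1 : c * P ≤ deriv p z := by
    rw [← deriv_abs_odd hp.odd]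
    have := hp.deriv_lb |z| (by linarith)
    refine le_trans ?_ this
    have : P ≤ |z| ^ α := Real.rpow_le_rpow (by positivity) hz hα0
    gcongr
  have hw1 : deriv p w ≤ c / 2 * P := by
    by_cases hw0 : ξ₀ ≤ |w|
    · rw [← deriv_abs_odd hp.odd]
      refine (hp.deriv_ub _ hw0).trans ?_
      have e1 : |w| ≤ 4 / K₀ * (N₁ / 2) := by
        refine hw.trans ?_
        have : N₂ ≤ N₁ / K₀ := by rw [le_div_iff₀ (by linarith)]; linarith
        calc 2 * N₂ ≤ 2 * (N₁ / K₀) := by linarith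
          _ = _ := by ring
      have e2 : |w| ^ α ≤ (4 / K₀) * P := by
        calc |w| ^ α ≤ (4 / K₀ * (N₁ / 2)) ^ α := Real.rpow_le_rpow (abs_nonneg _) e1 hα0
          _ = (4 / K₀) ^ α * P := by
            rw [Real.mul_rpow (div_nonneg (by norm_num) (by linarith)) (by positivity)]
          _ ≤ (4 / K₀) * P := by
            have : (4 / K₀) ^ α ≤ (4 / K₀) ^ (1:ℝ) :=
              Real.rpow_le_rpow_of_exponent_ge (by positivity)
                (by rw [div_le_one (by linarith)]; exact k1) hα.1
            rw [Real.rpow_one] at this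
            gcongr
      have e3 : C * (4 / K₀) ≤ c / 2 := by
        rw [div_le_iff₀ hc] at k3
        rw [← mul_div_assoc, div_le_iff₀ (by linarith)]
        linarith
      calc C * |w| ^ α ≤ C * ((4 / K₀) * P) := by gcongr
        _ = C * (4 / K₀) * P := by ring
        _ ≤ _ := by gcongr
    · rw [not_le] at hw0
      have h1 := hM w (by rw [Set.mem_Icc, ← abs_le]; exact hw0.le)
      have h2 : deriv p w ≤ M := (le_abs_self _).trans h1
      refine h2.trans ?_
      have h3 : N₁ / 2 ≤ P := by
        have := Real.rpow_le_rpow_of_exponent_le (x := N₁ / 2) (by linarith) hα.1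
        rwa [Real.rpow_one] at this
      rw [div_le_iff₀ hc] at k4
      nlinarith
  have hP2 : N₁ ^ α / 4 ≤ P := by
    rw [hP, Real.div_rpow hN₁.le (by norm_num)]
    have : (2:ℝ) ^ α ≤ 4 := by
      calc (2:ℝ) ^ α ≤ 2 ^ (2:ℝ) := Real.rpow_le_rpow_of_exponent_le (by norm_num) hα.2
        _ = 4 := by norm_num
    gcongr
  nlinarith

lemma slope_int {p : ℝ → ℝ} (hd : Differentiable ℝ p) {s N₁ N₂ : ℝ}
    (hs : ∀ z w : ℝ, N₁ / 2 ≤ |z| → |w| ≤ 2 * N₂ → s ≤ deriv p z - deriv p w)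
    (ξ x y : ℝ) (hxy : x < y) (hx : |ξ - x| ≤ 2 * N₂) (hy : |ξ - y| ≤ 2 * N₂)
    (hor : N₁ / 2 ≤ x ∨ y ≤ -(N₁ / 2)) :
    s * (y - x) ≤ (p y + p (ξ - y)) - (p x + p (ξ - x)) := by
  have hd2 : ∀ z, HasDerivAt (fun z => p z + p (ξ - z)) (deriv p z - deriv p (ξ - z)) z := by
    intro z
    have h1 := (hd z).hasDerivAt
    have h2 := HasDerivAt.comp_const_sub ξ z (hd (ξ - z)).hasDerivAt
    exact (h1.add h2).congr_deriv (by ring)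
  have hD : Differentiable ℝ (fun z => p z + p (ξ - z)) := fun z => (hd2 z).differentiableAt
  refine Convex.mul_sub_le_image_sub_of_le_deriv (convex_Icc x y) hD.continuous.continuousOn
    hD.differentiableOn ?_ x (left_mem_Icc.2 hxy.le) y (right_mem_Icc.2 hxy.le) hxy.le
  intro z hz
  rw [interior_Icc] at hz
  rw [(hd2 z).deriv]
  apply hs
  · rcases hor with h | h
    · exact le_trans (by linarith [hz.1]) (le_abs_self z)
    · exact le_trans (by linarith [hz.2]) (neg_le_abs z)
  · rw [abs_le] at hx hy ⊢
    constructor <;> linarith [hz.1, hz.2, hx.1, hx.2, hy.1, hy.2]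

lemma count_dir {p : ℝ → ℝ} (hd : Differentiable ℝ p) {s N₁ N₂ : ℝ} (hs0 : 0 < s)
    (hs : ∀ z w : ℝ, N₁ / 2 ≤ |z| → |w| ≤ 2 * N₂ → s ≤ deriv p z - deriv p w)
    (ξ τ R : ℝ) (hR : 0 ≤ R) (T : Finset ℤ)
    (hT : ∀ x ∈ T, N₁ / 2 ≤ |(x:ℝ)| ∧ |ξ - x| ≤ 2 * N₂ ∧ |τ - p x - p (ξ - x)| ≤ R) :
    (T.card : ℝ) ≤ 2 * (2 * R / s + 1) := by
  classical
  have gen : ∀ T' : Finset ℤ, T' ⊆ T →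
      (∀ x ∈ T', ∀ y ∈ T', x < y → (N₁ / 2 ≤ (x:ℝ) ∨ (y:ℝ) ≤ -(N₁ / 2))) →
      (T'.card : ℝ) ≤ 2 * R / s + 1 := by
    intro T' hsub hor
    apply card_diam _ _ (by positivity)
    intro x hx y hy hxy
    obtain ⟨-, hx2, hx3⟩ := hT x (hsub hx)
    obtain ⟨-, hy2, hy3⟩ := hT y (hsub hy)
    have := slope_int hd hs ξ x y (by exact_mod_cast hxy) hx2 hy2 (hor x hx y hy hxy)
    rw [le_div_iff₀ hs0]
    rw [abs_le] at hx3 hy3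
    linarith [hx3.1, hx3.2, hy3.1, hy3.2]
  have g1 := gen (T.filter (fun x => 0 ≤ x)) (Finset.filter_subset _ _) (by
    intro x hx y hy _
    left
    obtain ⟨h1, h2⟩ := Finset.mem_filter.1 hx
    have h3 := (hT x h1).1
    rwa [abs_of_nonneg (by exact_mod_cast h2)] at h3)
  have g2 := gen (T.filter (fun x => ¬ 0 ≤ x)) (Finset.filter_subset _ _) (by
    intro x hx y hy _
    right
    obtain ⟨h1, h2⟩ := Finset.mem_filter.1 hy
    have h3 := (hT y h1).1
    rw [abs_of_neg (by exact_mod_cast not_le.1 h2)] at h3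
    linarith)
  have h := Finset.card_filter_add_card_filter_not (s := T) (fun x : ℤ => 0 ≤ x)
  have h' : ((T.filter (fun x => 0 ≤ x)).card : ℝ) + (T.filter (fun x => ¬ 0 ≤ x)).card = T.card := by
    exact_mod_cast h
  linarith


lemma final_alg {J J₁ J₂ Lm LM Nm NM C' α : ℝ} (hJ : 0 ≤ J) (h1 : 0 ≤ J₁) (h2 : 0 ≤ J₂) (hLm : 0 ≤ Lm)
    (hLM : 0 ≤ LM) (hNm : 0 ≤ Nm) (hNM : 0 < NM) (hC : 0 ≤ C')
    (h : J ≤ (4 * Lm) * (C' * min (LM / NM ^ α + 1) Nm) * J₁ * J₂) :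
    J ^ ((1:ℝ)/2) ≤ (4 * C') ^ ((1:ℝ)/2) * Lm ^ ((1:ℝ)/2) *
      min (LM ^ ((1:ℝ)/2) / NM ^ (α / 2) + 1) (Nm ^ ((1:ℝ)/2)) *
      J₁ ^ ((1:ℝ)/2) * J₂ ^ ((1:ℝ)/2) := by
  have hP : 0 < NM ^ α := Real.rpow_pos_of_pos hNM _
  have hmin : 0 ≤ min (LM / NM ^ α + 1) Nm := le_min (by positivity) hNm
  have e : (4 * Lm) * (C' * min (LM / NM ^ α + 1) Nm) * J₁ * J₂ =
      (4 * C') * Lm * min (LM / NM ^ α + 1) Nm * J₁ * J₂ := by ring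
  rw [e] at h
  have h3 := Real.rpow_le_rpow hJ h (by norm_num : (0:ℝ) ≤ 1 / 2)
  rw [Real.mul_rpow (by positivity) h2, Real.mul_rpow (by positivity) h1,
    Real.mul_rpow (by positivity) hmin, Real.mul_rpow (by positivity) hLm] at h3
  refine h3.trans ?_
  have hk : (min (LM / NM ^ α + 1) Nm) ^ ((1:ℝ)/2) ≤
      min (LM ^ ((1:ℝ)/2) / NM ^ (α / 2) + 1) (Nm ^ ((1:ℝ)/2)) := by
    apply le_min
    · calc (min (LM / NM ^ α + 1) Nm) ^ ((1:ℝ)/2) ≤ (LM / NM ^ α + 1) ^ ((1:ℝ)/2) :=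
            Real.rpow_le_rpow hmin (min_le_left _ _) (by norm_num)
        _ ≤ (LM / NM ^ α) ^ ((1:ℝ)/2) + 1 ^ ((1:ℝ)/2) :=
            Real.rpow_add_le_add_rpow (by positivity) (by norm_num) (by norm_num) (by norm_num)
        _ = _ := by
            rw [Real.div_rpow hLM hP.le, Real.one_rpow, ← Real.rpow_mul hNM.le]
            congr 3
            ring
    · exact Real.rpow_le_rpow hmin (min_le_right _ _) (by norm_num)
  gcongr

lemma l2sq_int_nonneg (U : ℝ → ℤ → ℂ) : 0 ≤ ∫ t, l2sq (U t) :=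
  integral_nonneg fun _ => tsum_nonneg fun _ => sq_nonneg _

/-- Proposition `prop_stri1_2`, estimate (bil2):
improved bilinear estimate in the non-balanced case `N₁∨N₂ ≫ N₁∧N₂`. -/
theorem bilinear_L2_estimate_II
    (α ξ₀ c₀ C₀ : ℝ) (hα : α ∈ Set.Icc (1:ℝ) 2)
    (p : ℝ → ℝ) (hp : Hyp1 α ξ₀ c₀ C₀ p)
    (χ : ℝ → ℝ) (hχ : CutoffFun χ)
    (a : ℝ → ℝ → ℂ) (ha : ∀ x y : ℝ, ‖a x y‖ ≤ 1) :
    ∃ K₀ : ℝ, 1 ≤ K₀ ∧ ∃ C : ℝ, 0 < C ∧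
      ∀ (U₁ U₂ : ℝ → ℤ → ℂ),
        (∀ t : ℝ, ∀ ξ : ℤ, U₁ t (-ξ) = (starRingEnd ℂ) (U₁ t ξ)) →
        (∀ t : ℝ, ∀ ξ : ℤ, U₂ t (-ξ) = (starRingEnd ℂ) (U₂ t ξ)) →
        MemL2 U₁ → MemL2 U₂ →
        ∀ (n₁ n₂ l₁ l₂ : ℕ),
          K₀ * min ((2:ℝ) ^ n₁) ((2:ℝ) ^ n₂) ≤ max ((2:ℝ) ^ n₁) ((2:ℝ) ^ n₂) →
          L2full (fun t => Lam a
              (Qle χ p l₁ (fun s => PN χ ((2:ℝ) ^ n₁) (U₁ s)) t)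
              (Qle χ p l₂ (fun s => PN χ ((2:ℝ) ^ n₂) (U₂ s)) t)) ≤
            C * (min ((2:ℝ) ^ l₁) ((2:ℝ) ^ l₂)) ^ ((1:ℝ)/2) *
              min ((max ((2:ℝ) ^ l₁) ((2:ℝ) ^ l₂)) ^ ((1:ℝ)/2) /
                    (max ((2:ℝ) ^ n₁) ((2:ℝ) ^ n₂)) ^ (α/2) + 1)
                  ((min ((2:ℝ) ^ n₁) ((2:ℝ) ^ n₂)) ^ ((1:ℝ)/2)) *
              L2full (Qle χ p l₁ (fun s => PN χ ((2:ℝ) ^ n₁) (U₁ s))) *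
              L2full (Qle χ p l₂ (fun s => PN χ ((2:ℝ) ^ n₂) (U₂ s))) := by
  obtain ⟨K₀, hK1, hK⟩ := slope_bound hα hp
  have hc := hp.c_pos
  have hd : Differentiable ℝ p := hp.smooth1.differentiable (by norm_num)
  have hC' : 0 < 128 / c₀ + 7 := by positivity
  refine ⟨K₀, hK1, (4 * (128 / c₀ + 7)) ^ ((1:ℝ)/2), by positivity, ?_⟩
  intro U₁ U₂ _ _ _ _ n₁ n₂ l₁ l₂ hN
  unfold L2full
  simp only [Qle_eq hχ]
  have n1p : (1:ℝ) ≤ 2 ^ n₁ := one_le_pow₀ (by norm_num)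
  have n2p : (1:ℝ) ≤ 2 ^ n₂ := one_le_pow₀ (by norm_num)
  have l1p : (1:ℝ) ≤ 2 ^ l₁ := one_le_pow₀ (by norm_num)
  have l2p : (1:ℝ) ≤ 2 ^ l₂ := one_le_pow₀ (by norm_num)
  have supp1 := hsym_supp hχ p l₁ n₁ U₁
  have supp2 := hsym_supp hχ p l₂ n₂ U₂
  have fin1 := hsym_fin hχ p l₁ n₁ U₁
  have fin2 := hsym_fin hχ p l₂ n₂ U₂
  have cc1 := hsym_cc hχ p l₁ (fun s => PN χ ((2:ℝ) ^ n₁) (U₁ s))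
  have cc2 := hsym_cc hχ p l₂ (fun s => PN χ ((2:ℝ) ^ n₂) (U₂ s))
  generalize hsym χ p l₁ (fun s => PN χ ((2:ℝ) ^ n₁) (U₁ s)) = h₁ at *
  generalize hsym χ p l₂ (fun s => PN χ ((2:ℝ) ^ n₂) (U₂ s)) = h₂ at *
  refine final_alg (l2sq_int_nonneg _) (l2sq_int_nonneg _) (l2sq_int_nonneg _)
    (le_min (by positivity) (by positivity)) (le_max_of_le_left (by positivity))
    (le_min (by positivity) (by positivity)) (lt_max_of_lt_left (by positivity)) hC'.le ?_
  have hNM : (1:ℝ) ≤ max (2 ^ n₁) (2 ^ n₂) := le_max_of_le_left n1p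
  have hNm : (1:ℝ) ≤ min (2 ^ n₁) (2 ^ n₂) := le_min n1p n2p
  have hLm : (1:ℝ) ≤ min (2 ^ l₁) (2 ^ l₂) := le_min l1p l2p
  have hLM : (1:ℝ) ≤ max (2 ^ l₁) (2 ^ l₂) := le_max_of_le_left l1p
  have hPM : 0 < (max ((2:ℝ) ^ n₁) (2 ^ n₂)) ^ α := by positivity
  have hs0 : 0 < c₀ / 8 * (max ((2:ℝ) ^ n₁) (2 ^ n₂)) ^ α := by positivity
  have hsl := hK _ _ hNm hN
  apply core h₁ h₂ (fun ξ => (cc1 ξ).1) (fun ξ => (cc2 ξ).1) (fun ξ => (cc1 ξ).2)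
    (fun ξ => (cc2 ξ).2) _ _ fin1 fin2 a ha
  · positivity
  · positivity
  · intro ξ₁ ξ₂ τ
    rcases le_total ((2:ℝ) ^ l₁) (2 ^ l₂) with hl | hl
    · refine ⟨p ξ₁ - 2 * 2 ^ l₁, fun s hs => ?_⟩
      have := abs_le.1 (supp1 _ _ (left_ne_zero_of_mul hs)).1
      rw [min_eq_left hl]
      constructor <;> linarith [this.1, this.2]
    · refine ⟨τ - p ξ₂ - 2 * 2 ^ l₂, fun s hs => ?_⟩
      have := abs_le.1 (supp2 _ _ (right_ne_zero_of_mul hs)).1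
      rw [min_eq_right hl]
      constructor <;> linarith [this.1, this.2]
  · intro ξ τ
    classical
    let T : Finset ℤ := (Finset.Icc (-(2 * 2 ^ n₁) : ℤ) (2 * 2 ^ n₁)).filter
      (fun ξ₁ => ∃ s, h₁ ξ₁ s * h₂ (ξ - ξ₁) (τ - s) ≠ 0)
    refine ⟨T, ?_, ?_⟩
    swap
    · intro ξ₁ hξ₁ s
      by_contra h
      apply hξ₁
      refine Finset.mem_filter.2 ⟨?_, s, h⟩
      by_contra h'
      exact (left_ne_zero_of_mul h) (fin1 _ h' s)
    have hT : ∀ x ∈ T, (2:ℝ) ^ n₁ / 2 ≤ |(x:ℝ)| ∧ |(x:ℝ)| ≤ 2 * 2 ^ n₁ ∧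
        (2:ℝ) ^ n₂ / 2 ≤ |(ξ:ℝ) - x| ∧ |(ξ:ℝ) - x| ≤ 2 * 2 ^ n₂ ∧
        |τ - p x - p (ξ - x)| ≤ 4 * max (2 ^ l₁) (2 ^ l₂) := by
      intro x hx
      obtain ⟨-, s, hs⟩ := Finset.mem_filter.1 hx
      obtain ⟨a1, a2, a3⟩ := supp1 _ _ (left_ne_zero_of_mul hs)
      obtain ⟨b1, b2, b3⟩ := supp2 _ _ (right_ne_zero_of_mul hs)
      push_cast at b1 b2 b3
      refine ⟨a2, a3, b2, b3, ?_⟩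
      have m1 := le_max_left ((2:ℝ) ^ l₁) (2 ^ l₂)
      have m2 := le_max_right ((2:ℝ) ^ l₁) (2 ^ l₂)
      rw [abs_le] at a1 b1 ⊢
      constructor <;> linarith [a1.1, a1.2, b1.1, b1.2]
    have hcard1 : (T.card : ℝ) ≤ 2 * (2 * (4 * max ((2:ℝ) ^ l₁) (2 ^ l₂)) /
        (c₀ / 8 * (max ((2:ℝ) ^ n₁) (2 ^ n₂)) ^ α) + 1) := by
      rcases le_total ((2:ℝ) ^ n₁) (2 ^ n₂) with hn | hn
      · have hi : (T.image (fun x => ξ - x)).card = T.card :=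
          Finset.card_image_of_injective _ (fun x y h => by simpa using h)
        rw [← hi]
        refine count_dir hd hs0 hsl ξ τ _ (by positivity) _ ?_
        intro y hy
        obtain ⟨x, hx, rfl⟩ := Finset.mem_image.1 hy
        obtain ⟨a2, a3, b2, b3, e⟩ := hT x hx
        push_cast
        rw [max_eq_right hn, min_eq_left hn, sub_sub_cancel]
        refine ⟨b2, a3, ?_⟩
        rwa [sub_right_comm]
      · refine count_dir hd hs0 hsl ξ τ _ (by positivity) _ ?_
        intro x hx
        obtain ⟨a2, a3, b2, b3, e⟩ := hT x hx
        rw [max_eq_left hn, min_eq_right hn]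
        exact ⟨a2, b3, e⟩
    have hcard2 : (T.card : ℝ) ≤ 4 * min ((2:ℝ) ^ n₁) (2 ^ n₂) + 1 := by
      apply card_diam _ _ (by positivity)
      intro x hx y hy _
      obtain ⟨-, a3, -, b3, -⟩ := hT x hx
      obtain ⟨-, a3', -, b3', -⟩ := hT y hy
      rw [abs_le] at a3 b3 a3' b3'
      rcases min_choice ((2:ℝ) ^ n₁) (2 ^ n₂) with h | h <;> rw [h] <;>
        linarith [a3.1, a3.2, b3.1, b3.2, a3'.1, a3'.2, b3'.1, b3'.2]
    rw [mul_min_of_nonneg _ _ hC'.le]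
    have hq : 0 < 128 / c₀ := by positivity
    apply le_min
    · refine hcard1.trans ?_
      have e : 2 * (4 * max ((2:ℝ) ^ l₁) (2 ^ l₂)) / (c₀ / 8 * (max ((2:ℝ) ^ n₁) (2 ^ n₂)) ^ α) =
          64 / c₀ * (max ((2:ℝ) ^ l₁) (2 ^ l₂) / (max ((2:ℝ) ^ n₁) (2 ^ n₂)) ^ α) := by
        field_simp; ring
      rw [e]
      have hX : 0 ≤ max ((2:ℝ) ^ l₁) (2 ^ l₂) / (max ((2:ℝ) ^ n₁) (2 ^ n₂)) ^ α := by positivity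
      generalize max ((2:ℝ) ^ l₁) (2 ^ l₂) / (max ((2:ℝ) ^ n₁) (2 ^ n₂)) ^ α = X at *
      have : 128 / c₀ = 2 * (64 / c₀) := by ring
      rw [this] at hq ⊢
      nlinarith
    · refine hcard2.trans ?_
      nlinarith

end
end

section
/- Let α ∈ [1,2], let a ∈ L^∞(R²) with ‖a‖_{L^∞} ≤ 1, let N₁, N₂ ≥ 1 be dyadic numbers, let 0 < T < 1 and let φ₁, φ₂ ∈ L²(T). Then there exists C > 0 depending only on p_{α+1} such that for every interval I ⊂ R with |I| ≤ (N₁∨N₂)^{−1} T: ‖Λ_a(e^{−tL_{α+1}}P_{N₁}φ₁, e^{−tL_{α+1}}P_{N₂}φ₂)‖_{L²(I; L²(T))} ≤ C T^{1/4} (N₁∨N₂)^{−α/4} ‖P_{N₁}φ₁‖_{L²(T)} ‖P_{N₂}φ₂‖_{L²(T)}. -/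
open MeasureTheory Complex Real Set Filter
open scoped ENNReal NNReal

noncomputable section

lemma summ_gauss : Summable (fun n : ℤ => Real.exp (-(n:ℝ)^2)) := by
  have key : Summable (fun n : ℕ => Real.exp (-(n:ℝ)^2)) := by
    refine Summable.of_nonneg_of_le (fun n => (Real.exp_pos _).le) (fun n => ?_)
      Real.summable_exp_neg_nat
    apply Real.exp_le_exp.2
    have : (n:ℝ) ≤ (n:ℝ)^2 := by
      exact_mod_cast Nat.le_self_pow (by norm_num) n
    linarith
  refine Summable.of_nat_of_neg (by simpa using key) (by simpa using key)

lemma gauss_int (R : ℝ) (hR : 0 < R) (A μ : ℝ) :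
    Integrable (fun t : ℝ => cexp (I * μ * t) * cexp (-((1/R^2 : ℝ):ℂ) * ((t - A : ℝ):ℂ)^2)) ∧
    ‖∫ t : ℝ, cexp (I * μ * t) * cexp (-((1/R^2 : ℝ):ℂ) * ((t - A : ℝ):ℂ)^2)‖
      = √π * R * Real.exp (-(R^2 * μ^2 / 4)) := by
  have hb : (0:ℝ) < 1 / R^2 := by positivity
  constructor
  · have h1 : Integrable (fun t : ℝ => Real.exp (-(1/R^2) * (t-A)^2)) :=
      (integrable_exp_neg_mul_sq hb).comp_sub_right A
    refine h1.mono (by fun_prop) (Eventually.of_forall fun t => ?_)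
    rw [norm_mul, Complex.norm_exp, Complex.norm_exp]
    have e : -((1/R^2 : ℝ):ℂ) * ((t - A : ℝ):ℂ)^2 = ((-(1/R^2) * (t-A)^2 : ℝ) : ℂ) := by
      push_cast; ring
    rw [e, Complex.ofReal_re, Real.norm_of_nonneg (Real.exp_pos _).le]
    simp
  · have h0 := integral_sub_right_eq_self (μ := volume)
      (fun t : ℝ => cexp (I * μ * (t + A : ℝ)) * cexp (-((1/R^2 : ℝ):ℂ) * ((t : ℝ):ℂ)^2)) A
    simp only [sub_add_cancel] at h0
    rw [h0]
    have : (fun t : ℝ => cexp (I * μ * (t + A : ℝ)) * cexp (-((1/R^2 : ℝ):ℂ) * ((t : ℝ):ℂ)^2))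
      = fun t : ℝ => cexp (I * μ * A) * (cexp (I * μ * t) * cexp (-((1/R^2 : ℝ):ℂ) * ((t : ℝ):ℂ)^2)) := by
      funext t
      rw [← mul_assoc, ← Complex.exp_add (I * μ * A)]
      congr 2
      push_cast; ring
    rw [this, integral_const_mul, fourierIntegral_gaussian (by rw [Complex.ofReal_re]; exact hb)]
    rw [norm_mul, norm_mul, Complex.norm_exp]
    have e1 : (I * (μ:ℂ) * A).re = 0 := by simp
    have e2 : ((π:ℂ) / ((1/R^2:ℝ):ℂ)) = ((π * R^2 : ℝ) : ℂ) := by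
      push_cast; field_simp
    have e3 : (-(μ:ℂ)^2 / (4 * ((1/R^2:ℝ):ℂ))) = ((-(R^2 * μ^2 / 4) : ℝ) : ℂ) := by
      have : (R:ℂ) ≠ 0 := by exact_mod_cast hR.ne'
      push_cast; field_simp
    rw [e1, e2, e3, Complex.norm_cpow_eq_rpow_re_of_pos (by positivity), ← Complex.ofReal_exp,
      Complex.norm_real, Real.norm_of_nonneg (Real.exp_pos _).le]
    have : ((1/2:ℂ)).re = 1/2 := by norm_num
    rw [this, ← Real.sqrt_eq_rpow, Real.sqrt_mul (by positivity), Real.sqrt_sq hR.le]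
    simp

/-- Large sieve inequality with a Gaussian majorant. -/
lemma gauss_sieve (S : Finset ℤ) (lam : ℤ → ℝ) (c : ℤ → ℂ) (R : ℝ) (hR : 0 < R) (A B : ℝ)
    (hAB : B - A ≤ R)
    (hsep : ∀ x ∈ S, ∀ y ∈ S, 2 * |(x:ℝ) - y| ≤ R * |lam x - lam y|) :
    ∫ t in Set.Ioo A B, ‖∑ x ∈ S, c x * cexp (I * lam x * t)‖ ^ 2
      ≤ (Real.exp 1 * √π * ∑' n : ℤ, Real.exp (-(n:ℝ)^2)) * R * ∑ x ∈ S, ‖c x‖ ^ 2 := by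
  set f : ℝ → ℝ := fun t => ‖∑ x ∈ S, c x * cexp (I * lam x * t)‖ ^ 2 with hf
  set g : ℝ → ℝ := fun t => Real.exp (-(1/R^2) * (t-A)^2) * f t with hg
  have hcont : Continuous f := by fun_prop
  have hgc : ∀ t : ℝ, ((g t : ℝ) : ℂ) = ∑ x ∈ S, ∑ y ∈ S, (c x * (starRingEnd ℂ) (c y)) *
      (cexp (I * (lam x - lam y : ℝ) * t) * cexp (-((1/R^2 : ℝ):ℂ) * ((t - A : ℝ):ℂ)^2)) := by
    intro t
    simp only [hg, hf]
    push_cast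
    rw [← Complex.mul_conj', map_sum, Finset.sum_mul_sum, Finset.mul_sum]
    refine Finset.sum_congr rfl fun x _ => ?_
    rw [Finset.mul_sum]
    refine Finset.sum_congr rfl fun y _ => ?_
    rw [map_mul, ← Complex.exp_conj]
    have : cexp (I * (↑(lam x) - ↑(lam y)) * ↑t) = cexp (I * lam x * t) * cexp ((starRingEnd ℂ) (I * lam y * t)) := by
      rw [← Complex.exp_add]
      simp
      ring_nf
    rw [this]; ring
  have hint : ∀ x ∈ S, ∀ y ∈ S, Integrable (fun t : ℝ => (c x * (starRingEnd ℂ) (c y)) *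
      (cexp (I * (lam x - lam y : ℝ) * t) * cexp (-((1/R^2 : ℝ):ℂ) * ((t - A : ℝ):ℂ)^2))) :=
    fun x _ y _ => (gauss_int R hR A (lam x - lam y)).1.const_mul _
  have hgint : Integrable g := by
    have : Integrable (fun t => ((g t : ℝ) : ℂ)) := by
      simp_rw [hgc]
      exact integrable_finsetSum _ fun x hx => integrable_finsetSum _ fun y hy => hint x hx y hy
    have h2 := this.re
    simpa using h2
  have hg0 : ∀ t, 0 ≤ g t := fun t => by simp only [hg, hf]; positivity
  -- Schur bound
  have hmain : ∫ t, g t ≤ √π * (∑' n : ℤ, Real.exp (-(n:ℝ)^2)) * R * ∑ x ∈ S, ‖c x‖ ^ 2 := by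
    have h1 : ∫ t, g t = ‖∫ t, ((g t : ℝ) : ℂ)‖ := by
      rw [integral_complex_ofReal, Complex.norm_real, Real.norm_of_nonneg (integral_nonneg hg0)]
    rw [h1]
    simp_rw [hgc]
    rw [integral_finsetSum _ (fun x hx => integrable_finsetSum _ fun y hy => hint x hx y hy)]
    have h2 : ∀ x ∈ S, ∫ t : ℝ, ∑ y ∈ S, (c x * (starRingEnd ℂ) (c y)) *
      (cexp (I * (lam x - lam y : ℝ) * t) * cexp (-((1/R^2 : ℝ):ℂ) * ((t - A : ℝ):ℂ)^2))
      = ∑ y ∈ S, ∫ t : ℝ, (c x * (starRingEnd ℂ) (c y)) *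
      (cexp (I * (lam x - lam y : ℝ) * t) * cexp (-((1/R^2 : ℝ):ℂ) * ((t - A : ℝ):ℂ)^2)) :=
      fun x hx => integral_finsetSum _ (fun y hy => hint x hx y hy)
    rw [Finset.sum_congr rfl h2]
    set E : ℤ → ℝ := fun n => Real.exp (-(n:ℝ)^2) with hE
    have hbd : ∀ x ∈ S, ∀ y ∈ S, ‖∫ t : ℝ, (c x * (starRingEnd ℂ) (c y)) *
      (cexp (I * (lam x - lam y : ℝ) * t) * cexp (-((1/R^2 : ℝ):ℂ) * ((t - A : ℝ):ℂ)^2))‖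
      ≤ √π * R * ((‖c x‖^2 * E (x - y) + ‖c y‖^2 * E (x-y)) / 2) := by
      intro x hx y hy
      rw [integral_const_mul, norm_mul, (gauss_int R hR A (lam x - lam y)).2, norm_mul,
        RCLike.norm_conj]
      have hE1 : Real.exp (-(R^2 * (lam x - lam y)^2 / 4)) ≤ E (x-y) := by
        apply Real.exp_le_exp.2
        have h := hsep x hx y hy
        have h' := pow_le_pow_left₀ (by positivity) h 2
        rw [mul_pow, mul_pow, sq_abs, sq_abs] at h'
        push_cast
        linarith
      have hE0 : 0 ≤ E (x - y) := (Real.exp_pos _).le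
      calc _ ≤ ‖c x‖ * ‖c y‖ * (√π * R * E (x-y)) := by gcongr
        _ = √π * R * E (x-y) * (‖c x‖ * ‖c y‖) := by ring
        _ ≤ √π * R * E (x-y) * ((‖c x‖^2 + ‖c y‖^2)/2) := by
          gcongr
          nlinarith [sq_nonneg (‖c x‖ - ‖c y‖)]
        _ = _ := by ring
    have hsum1 : ∀ x : ℤ, ∑ y ∈ S, E (x - y) ≤ ∑' n, E n := by
      intro x
      have := ((Equiv.subLeft x).tsum_eq E)
      rw [← this]
      exact (((Equiv.subLeft x).summable_iff (f := E)).2 summ_gauss).sum_le_tsum S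
        (fun _ _ => (Real.exp_pos _).le)
    have hsum2 : ∀ y : ℤ, ∑ x ∈ S, E (x - y) ≤ ∑' n, E n := by
      intro y
      have := ((Equiv.subRight y).tsum_eq E)
      rw [← this]
      exact (((Equiv.subRight y).summable_iff (f := E)).2 summ_gauss).sum_le_tsum S
        (fun _ _ => (Real.exp_pos _).le)
    calc _ ≤ ∑ x ∈ S, ∑ y ∈ S, √π * R * ((‖c x‖^2 * E (x - y) + ‖c y‖^2 * E (x-y)) / 2) := by
          refine (norm_sum_le _ _).trans (Finset.sum_le_sum fun x hx => ?_)
          exact (norm_sum_le _ _).trans (Finset.sum_le_sum fun y hy => hbd x hx y hy)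
      _ = √π * R / 2 * (∑ x ∈ S, ‖c x‖^2 * ∑ y ∈ S, E (x-y)
            + ∑ y ∈ S, ‖c y‖^2 * ∑ x ∈ S, E (x-y)) := by
          simp_rw [Finset.mul_sum]
          rw [Finset.sum_comm (f := fun y x => ‖c y‖^2 * E (x-y)), ← Finset.sum_add_distrib,
            Finset.mul_sum]
          refine Finset.sum_congr rfl fun x _ => ?_
          rw [← Finset.sum_add_distrib, Finset.mul_sum]
          refine Finset.sum_congr rfl fun y _ => ?_
          ring
      _ ≤ √π * R / 2 * (∑ x ∈ S, ‖c x‖^2 * (∑' n, E n) + ∑ y ∈ S, ‖c y‖^2 * (∑' n, E n)) := by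
          gcongr with x hx y hy
          · exact hsum1 x
          · exact hsum2 y
      _ = _ := by
          rw [← Finset.sum_mul]; ring
  have hle : ∫ t in Set.Ioo A B, f t ≤ Real.exp 1 * ∫ t, g t := by
    rw [← integral_const_mul]
    calc ∫ t in Set.Ioo A B, f t ≤ ∫ t in Set.Ioo A B, Real.exp 1 * g t := by
          refine setIntegral_mono_on ?_ (hgint.const_mul _).integrableOn measurableSet_Ioo ?_
          · exact (hcont.integrableOn_Icc).mono_set Ioo_subset_Icc_self
          · intro t ht
            have h1 : 0 ≤ f t := by simp only [hf]; positivity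
            have h2 : (t-A)^2 ≤ R^2 := by
              apply pow_le_pow_left₀ <;> linarith [ht.1, ht.2]
            have h3 : (1/R^2) * (t-A)^2 ≤ 1 := by
              rw [one_div, inv_mul_le_iff₀ (by positivity)]; linarith
            have h4 : 1 ≤ Real.exp 1 * Real.exp (-(1/R^2) * (t-A)^2) := by
              rw [← Real.exp_add]; apply Real.one_le_exp; linarith
            simp only [hg]
            rw [← mul_assoc]
            exact le_mul_of_one_le_left h1 h4
      _ ≤ _ := setIntegral_le_integral (hgint.const_mul _)
          (Eventually.of_forall fun t => mul_nonneg (Real.exp_pos _).le (hg0 t))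
  calc _ ≤ _ := hle
    _ ≤ _ := mul_le_mul_of_nonneg_left hmain (Real.exp_pos _).le
    _ = _ := by ring
lemma p_deriv_even {α ξ₀ c C : ℝ} {p : ℝ → ℝ} (hp : Hyp1 α ξ₀ c C p) (x : ℝ) :
    deriv p (-x) = deriv p x := by
  have h : (fun x => p (-x)) = fun x => -p x := funext hp.odd
  have h1 := deriv_comp_neg p x
  rw [h, deriv.fun_neg] at h1
  linarith

lemma p_conv {α ξ₀ c C : ℝ} (hα : α ∈ Set.Icc (1:ℝ) 2) {p : ℝ → ℝ} (hp : Hyp1 α ξ₀ c C p) :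
    ∃ N₀ : ℝ, 1 ≤ N₀ ∧ ∀ N : ℝ, N₀ ≤ N → ∀ x y : ℝ, N / 2 ≤ x → 0 ≤ y → y ≤ x →
      c / 8 * N ^ (α - 1) * (x - y) ≤ deriv p x - deriv p y := by
  have hc := hp.c_pos
  have hx0 := hp.xi0_pos
  have hcont : Continuous (deriv p) := hp.smooth1.continuous_deriv le_rfl
  obtain ⟨K, hK⟩ := (isCompact_Icc (a := (0:ℝ)) (b := ξ₀)).bddAbove_image hcont.continuousOn
  have hK' : ∀ y, 0 ≤ y → y ≤ ξ₀ → deriv p y ≤ K := fun y h1 h2 =>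
    hK (Set.mem_image_of_mem _ ⟨h1, h2⟩)
  have hdiff : ∀ x, 0 < x → DifferentiableAt ℝ (deriv p) x := by
    intro x hx
    have := (hp.smooth2 x hx.ne')
    have h2 : ContDiffAt ℝ 1 (deriv p) x := this.derivWithin (by norm_num)
    exact h2.differentiableAt one_ne_zero
  have mvt : ∀ z x D : ℝ, ξ₀ ≤ z → z ≤ x → (∀ w, z ≤ w → D ≤ deriv (deriv p) w) →
      D * (x - z) ≤ deriv p x - deriv p z := by
    intro z x D hz hzx hD
    refine (convex_Icc z x).mul_sub_le_image_sub_of_le_deriv hcont.continuousOn ?_ ?_ z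
      ⟨le_rfl, hzx⟩ x ⟨hzx, le_rfl⟩ hzx
    · intro w hw
      rw [interior_Icc] at hw
      exact (hdiff w (by linarith [hw.1])).differentiableWithinAt
    · intro w hw
      rw [interior_Icc] at hw
      exact hD w hw.1.le
  refine ⟨max 4 (max (4 * ξ₀) (4 * K / c)), le_trans (by norm_num) (le_max_left _ _), ?_⟩
  intro N hN x y hx hy hyx
  have hN4 : 4 ≤ N := (le_max_left _ _).trans hN
  have hNx : 4 * ξ₀ ≤ N := ((le_max_left _ _).trans (le_max_right _ _)).trans hN
  have hNK : 4 * K / c ≤ N := ((le_max_right _ _).trans (le_max_right _ _)).trans hN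
  have hNK' : K ≤ c * (N / 4) := by
    rw [div_le_iff₀ hc] at hNK; linarith
  set z := max y (x/2) with hz
  have hz1 : N / 4 ≤ z := le_trans (by linarith) (le_max_right _ _)
  have hzx : z ≤ x := max_le hyx (by linarith)
  have hD : ∀ w, z ≤ w → c / 4 * N ^ (α - 1) ≤ deriv (deriv p) w := by
    intro w hw
    refine le_trans ?_ (hp.deriv2_lb w (by linarith))
    have h1 : (N/4) ^ (α-1) ≤ w ^ (α - 1) :=
      Real.rpow_le_rpow (by linarith) (by linarith) (by linarith [hα.1])
    have h2 : N ^ (α-1) / 4 ≤ (N/4)^(α-1) := by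
      rw [Real.div_rpow (by linarith) (by norm_num)]
      have h4 : (4:ℝ)^(α-1) ≤ 4 := by
        calc (4:ℝ)^(α-1) ≤ 4^(1:ℝ) :=
              Real.rpow_le_rpow_of_exponent_le (by norm_num) (by linarith [hα.2])
          _ = 4 := by norm_num
      have h5 : (0:ℝ) < 4^(α-1) := by positivity
      gcongr
    calc c / 4 * N ^ (α-1) = c * (N^(α-1)/4) := by ring
      _ ≤ _ := by gcongr; linarith
  have h1 := mvt z x _ (by linarith) hzx hD
  have h2 : deriv p y ≤ deriv p z := by
    rcases le_total (x/2) y with h | h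
    · rw [hz, max_eq_left h]
    · rw [max_eq_right h] at hz
      rcases le_total ξ₀ y with h' | h'
      · have := mvt y z 0 h' (by linarith) (fun w hw => by
          refine le_trans ?_ (hp.deriv2_lb w (by linarith))
          have : 0 ≤ w := by linarith
          positivity)
        linarith
      · refine (hK' y hy h').trans (hNK'.trans (le_trans ?_ (hp.deriv_lb z (by linarith))))
        gcongr
        calc N / 4 ≤ z := hz1
          _ = z ^ (1:ℝ) := (Real.rpow_one z).symm
          _ ≤ _ := Real.rpow_le_rpow_of_exponent_le (by linarith) hα.1
  have h3 : (x - y)/2 ≤ x - z := by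
    have : z ≤ (x+y)/2 := max_le (by linarith) (by linarith)
    linarith
  have h4 : 0 ≤ c / 4 * N ^ (α-1) := by positivity
  nlinarith [mul_le_mul_of_nonneg_left h3 h4]

lemma sep_base {α ξ₀ c C : ℝ} (hα : α ∈ Set.Icc (1:ℝ) 2) {p : ℝ → ℝ} (hp : Hyp1 α ξ₀ c C p) :
    ∃ N₀ : ℝ, 1 ≤ N₀ ∧ ∀ N : ℝ, N₀ ≤ N → ∀ M : ℝ, 0 < M → ∀ ξ : ℝ, M ≤ ξ →
      ∀ x x' : ℝ, N / 2 ≤ x → N / 2 ≤ x' → ξ + M ≤ 2 * x → ξ + M ≤ 2 * x' →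
      c / 8 * N ^ (α - 1) * M * |x - x'| ≤ |(p x + p (ξ - x)) - (p x' + p (ξ - x'))| := by
  obtain ⟨N₀, hN₀, H⟩ := p_conv hα hp
  refine ⟨N₀, hN₀, ?_⟩
  intro N hN M hM ξ hξ x x' hx hx' hxM hxM'
  wlog hle : x' ≤ x generalizing x x'
  · have := this x' x hx' hx hxM' hxM (le_of_not_ge hle)
    rwa [abs_sub_comm, abs_sub_comm (p x + p (ξ - x))]
  rw [abs_of_nonneg (sub_nonneg.2 hle)]
  refine le_trans ?_ (le_abs_self _)
  have hd : Differentiable ℝ p := hp.smooth1.differentiable one_ne_zero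
  have hdh : ∀ w, HasDerivAt (fun w => p w + p (ξ - w)) (deriv p w - deriv p (ξ - w)) w := by
    intro w
    have h1 := (hd w).hasDerivAt
    have h2 := (hd (ξ - w)).hasDerivAt.scomp w ((hasDerivAt_id w).const_sub ξ)
    have := h1.add h2
    simp only [smul_eq_mul, neg_mul, one_mul, ← sub_eq_add_neg] at this
    exact this
  refine (convex_Icc x' x).mul_sub_le_image_sub_of_le_deriv (f := fun w => p w + p (ξ - w))
    ?_ ?_ ?_ x' ⟨le_rfl, hle⟩ x ⟨hle, le_rfl⟩ hle
  · exact fun w _ => (hdh w).continuousAt.continuousWithinAt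
  · exact fun w _ => (hdh w).differentiableAt.differentiableWithinAt
  · intro w hw
    rw [interior_Icc] at hw
    rw [(hdh w).deriv]
    have he : deriv p (ξ - w) = deriv p |ξ - w| := by
      rcases abs_choice (ξ - w) with h | h
      · rw [h]
      · rw [h, p_deriv_even hp]
    have hw1 := hw.1
    have hab : |ξ - w| ≤ w - M := abs_le.2 ⟨by linarith, by linarith⟩
    rw [he]
    refine le_trans ?_ (H N hN w |ξ - w| (by linarith) (abs_nonneg _) (by linarith))
    have := hp.c_pos
    have hN1 : 0 < N := by linarith
    gcongr
    linarith

lemma sep_gen {α ξ₀ c C : ℝ} (hα : α ∈ Set.Icc (1:ℝ) 2) {p : ℝ → ℝ} (hp : Hyp1 α ξ₀ c C p) :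
    ∃ N₀ : ℝ, 1 ≤ N₀ ∧ ∀ N : ℝ, N₀ ≤ N → ∀ M : ℝ, 0 < M → ∀ ξ : ℝ, M ≤ |ξ| →
      ∀ σ : ℝ, (σ = 1 ∨ σ = -1) →
      ∀ x x' : ℝ, N / 2 ≤ max |x| |ξ - x| → N / 2 ≤ max |x'| |ξ - x'| →
        M ≤ σ * (2 * x - ξ) → M ≤ σ * (2 * x' - ξ) →
      c / 8 * N ^ (α - 1) * M * |x - x'| ≤ |(p x + p (ξ - x)) - (p x' + p (ξ - x'))| := by
  obtain ⟨N₀, hN₀, H⟩ := sep_base hα hp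
  refine ⟨N₀, hN₀, ?_⟩
  intro N hN M hM ξ hξ σ hσ x x' hx hx' hxM hxM'
  have aux : ∀ u v w : ℝ, w ≤ max |u| |v| → |u| ≤ |v| → w ≤ |v| := fun u v w h h' => by
    rwa [max_eq_right h'] at h
  rcases le_abs.1 hξ with h | h <;> rcases hσ with rfl | rfl
  · have k : ∀ x, N / 2 ≤ max |x| |ξ - x| → M ≤ 1 * (2 * x - ξ) → N / 2 ≤ x := by
      intro x hx hM
      have h1 : |x| = x := abs_of_nonneg (by linarith)
      rw [h1] at hx
      exact hx.trans (max_le le_rfl (abs_le.2 ⟨by linarith, by linarith⟩))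
    exact H N hN M hM ξ h x x' (k x hx hxM) (k x' hx' hxM') (by linarith) (by linarith)
  · have k : ∀ x, N / 2 ≤ max |x| |ξ - x| → M ≤ -1 * (2 * x - ξ) → N / 2 ≤ ξ - x := by
      intro x hx hM
      have h1 : |ξ - x| = ξ - x := abs_of_nonneg (by linarith)
      rw [h1] at hx
      exact hx.trans (max_le (abs_le.2 ⟨by linarith, by linarith⟩) le_rfl)
    have := H N hN M hM ξ h (ξ - x) (ξ - x') (k x hx hxM) (k x' hx' hxM')
      (by linarith) (by linarith)
    rw [sub_sub_cancel, sub_sub_cancel, sub_sub_sub_cancel_left, abs_sub_comm x' x] at this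
    rwa [add_comm (p x), add_comm (p x')]
  · have k : ∀ x, N / 2 ≤ max |x| |ξ - x| → M ≤ 1 * (2 * x - ξ) → N / 2 ≤ x - ξ := by
      intro x hx hM
      have h1 : |ξ - x| = x - ξ := by rw [abs_sub_comm]; exact abs_of_nonneg (by linarith)
      rw [h1] at hx
      exact hx.trans (max_le (abs_le.2 ⟨by linarith, by linarith⟩) le_rfl)
    have := H N hN M hM (-ξ) h (x - ξ) (x' - ξ) (k x hx hxM) (k x' hx' hxM')
      (by linarith) (by linarith)
    have e1 : ∀ x, p (x - ξ) + p (-ξ - (x - ξ)) = -(p x + p (ξ - x)) := by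
      intro x
      rw [show x - ξ = -(ξ - x) by ring, show -ξ - -(ξ - x) = -x by ring, hp.odd, hp.odd]; ring
    rw [e1, e1, sub_sub_sub_cancel_right, ← abs_neg (-_ - _)] at this
    convert this using 2
    ring
  · have k : ∀ x, N / 2 ≤ max |x| |ξ - x| → M ≤ -1 * (2 * x - ξ) → N / 2 ≤ -x := by
      intro x hx hM
      have h1 : |x| = -x := abs_of_nonpos (by linarith)
      rw [h1] at hx
      exact hx.trans (max_le le_rfl (abs_le.2 ⟨by linarith, by linarith⟩))
    have := H N hN M hM (-ξ) h (-x) (-x') (k x hx hxM) (k x' hx' hxM')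
      (by linarith) (by linarith)
    have e1 : ∀ x, p (-x) + p (-ξ - (-x)) = -(p x + p (ξ - x)) := by
      intro x
      rw [show -ξ - -x = -(ξ - x) by ring, hp.odd, hp.odd]; ring
    rw [e1, e1, neg_sub_neg, neg_sub_neg, abs_sub_comm x' x, abs_sub_comm (p x' + _)] at this
    exact this

lemma card_le_of_bdd (S : Finset ℤ) (a b : ℝ) (hab : a ≤ b + 1)
    (h : ∀ x ∈ S, a ≤ (x:ℝ) ∧ (x:ℝ) ≤ b) : (S.card : ℝ) ≤ b - a + 1 := by
  have hsub : S ⊆ Finset.Icc ⌈a⌉ ⌊b⌋ := fun x hx =>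
    Finset.mem_Icc.2 ⟨Int.ceil_le.2 (h x hx).1, Int.le_floor.2 (h x hx).2⟩
  have h1 : (S.card : ℝ) ≤ ((⌊b⌋ + 1 - ⌈a⌉).toNat : ℝ) := by
    have := Finset.card_le_card hsub
    rw [Int.card_Icc] at this
    exact_mod_cast this
  refine h1.trans ?_
  have h2 : (((⌊b⌋ + 1 - ⌈a⌉).toNat : ℤ) : ℝ) = ((max (⌊b⌋ + 1 - ⌈a⌉) 0 : ℤ) : ℝ) := by
    rw [Int.toNat_eq_max]
  rw [Int.cast_natCast] at h2
  rw [h2]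
  push_cast
  refine max_le ?_ (by linarith)
  linarith [Int.floor_le b, Int.le_ceil a]

lemma setInt_le (f : ℝ → ℝ) (hf : Continuous f) (A B L D : ℝ) (hL : 0 ≤ L) (hAB : B - A ≤ L)
    (hD : 0 ≤ D) (h : ∀ t, f t ≤ D) : ∫ t in Set.Ioo A B, f t ≤ L * D := by
  have h1 : ∫ t in Set.Ioo A B, f t ≤ ∫ _t in Set.Ioo A B, D := by
    refine setIntegral_mono_on ((hf.integrableOn_Icc).mono_set Ioo_subset_Icc_self) ?_
      measurableSet_Ioo (fun t _ => h t)
    exact integrableOn_const (by simp)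
  refine h1.trans ?_
  rw [setIntegral_const, smul_eq_mul]
  gcongr
  rw [Real.volume_real_Ioo]
  exact max_le hAB hL

lemma norm_expsum_le (S : Finset ℤ) (lam : ℤ → ℝ) (c : ℤ → ℂ) (t : ℝ) :
    ‖∑ x ∈ S, c x * cexp (I * lam x * t)‖ ≤ ∑ x ∈ S, ‖c x‖ := by
  refine (norm_sum_le _ _).trans (Finset.sum_le_sum fun x _ => ?_)
  rw [norm_mul, Complex.norm_exp]
  simp

lemma card_sieve (S : Finset ℤ) (lam : ℤ → ℝ) (c : ℤ → ℂ) (A B L : ℝ) (hL : 0 ≤ L)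
    (hAB : B - A ≤ L) :
    ∫ t in Set.Ioo A B, ‖∑ x ∈ S, c x * cexp (I * lam x * t)‖ ^ 2
      ≤ L * (S.card * ∑ x ∈ S, ‖c x‖ ^ 2) := by
  refine setInt_le _ (by fun_prop) A B L _ hL hAB (by positivity) fun t => ?_
  refine (pow_le_pow_left₀ (norm_nonneg _) (norm_expsum_le S lam c t) 2).trans ?_
  exact sq_sum_le_card_mul_sum_sq

lemma per_xi {α ξ₀ c₀ C₀ : ℝ} (hα : α ∈ Set.Icc (1:ℝ) 2) {p : ℝ → ℝ}
    (hp : Hyp1 α ξ₀ c₀ C₀ p) :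
    ∃ K : ℝ, 0 < K ∧ ∀ N M R L : ℝ, 1 ≤ N → 1 ≤ M → 0 < R → 0 ≤ L →
      N ^ (α - 1) * M * R = 1 → L * M ≤ R →
      ∀ A B : ℝ, B - A ≤ L → ∀ ξ : ℤ, M ≤ |(ξ:ℝ)| → ∀ S : Finset ℤ,
      (∀ x ∈ S, N / 2 ≤ max |(x:ℝ)| |(ξ:ℝ) - x| ∧ |(x:ℝ)| ≤ 2 * N) → ∀ c : ℤ → ℂ,
      ∫ t in Set.Ioo A B, ‖∑ x ∈ S, c x * cexp (I * (p x + p (ξ - x) : ℝ) * t)‖ ^ 2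
        ≤ K * R * ∑ x ∈ S, ‖c x‖ ^ 2 := by
  obtain ⟨N₀, hN₀, H⟩ := sep_gen hα hp
  have hc := hp.c_pos
  set G : ℝ := Real.exp 1 * √π * ∑' n : ℤ, Real.exp (-(n:ℝ)^2) with hG
  have hG0 : 0 ≤ G := by
    have : 0 ≤ ∑' n : ℤ, Real.exp (-(n:ℝ)^2) := tsum_nonneg fun n => (Real.exp_pos _).le
    positivity
  set K₁ : ℝ := max 1 (16 / c₀) with hK₁
  have hK1 : 1 ≤ K₁ := le_max_left _ _
  have hK2 : 2 ≤ K₁ * (c₀ / 8) := by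
    have : 16 / c₀ ≤ K₁ := le_max_right _ _
    rw [div_le_iff₀ hc] at this
    linarith
  refine ⟨max (5 * N₀) (3 * (2 + 2 * (G * K₁))), lt_of_lt_of_le (by linarith) (le_max_left _ _), ?_⟩
  intro N M R L hN hM hR hL hNMR hLM A B hAB ξ hξ S hS c
  set Q := ∑ x ∈ S, ‖c x‖ ^ 2 with hQ
  have hQ0 : 0 ≤ Q := by positivity
  have hLR : L ≤ R := le_trans (le_mul_of_one_le_right hL hM) hLM
  rcases le_total N N₀ with hlow | hhigh
  · -- low frequencies
    have hcard : (S.card : ℝ) ≤ 5 * N₀ := by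
      have := card_le_of_bdd S (-(2*N)) (2*N) (by linarith) (fun x hx => abs_le.1 (hS x hx).2)
      linarith
    refine (card_sieve S (fun x => p x + p (ξ - x)) c A B L hL hAB).trans ?_
    calc L * (S.card * Q) ≤ R * (5 * N₀ * Q) := by gcongr
      _ = 5 * N₀ * R * Q := by ring
      _ ≤ _ := by gcongr; exact le_max_left _ _
  · set lam : ℤ → ℝ := fun x => p x + p (ξ - x) with hlam
    set S1 := S.filter (fun x : ℤ => M ≤ 1 * (2 * (x:ℝ) - ξ)) with hS1
    set S' := S.filter (fun x : ℤ => ¬ M ≤ 1 * (2 * (x:ℝ) - ξ)) with hS'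
    set S2 := S'.filter (fun x : ℤ => M ≤ -1 * (2 * (x:ℝ) - ξ)) with hS2
    set S3 := S'.filter (fun x : ℤ => ¬ M ≤ -1 * (2 * (x:ℝ) - ξ)) with hS3
    have hsplit : ∀ f : ℤ → ℂ, ∑ x ∈ S, f x = ∑ x ∈ S1, f x + (∑ x ∈ S2, f x + ∑ x ∈ S3, f x) := by
      intro f
      rw [hS1, hS2, hS3, Finset.sum_filter_add_sum_filter_not, hS',
        Finset.sum_filter_add_sum_filter_not]
    have sub1 : S1 ⊆ S := Finset.filter_subset _ _
    have sub2 : S2 ⊆ S := (Finset.filter_subset _ _).trans (Finset.filter_subset _ _)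
    have sub3 : S3 ⊆ S := (Finset.filter_subset _ _).trans (Finset.filter_subset _ _)
    have hQle : ∀ U ⊆ S, ∑ x ∈ U, ‖c x‖^2 ≤ Q := fun U hU =>
      Finset.sum_le_sum_of_subset_of_nonneg hU (fun _ _ _ => by positivity)
    have hR' : 0 < K₁ * R := by positivity
    have hABR : B - A ≤ K₁ * R := hAB.trans (hLR.trans (le_mul_of_one_le_left hR.le hK1))
    have hsep : ∀ σ : ℝ, (σ = 1 ∨ σ = -1) → ∀ U ⊆ S, (∀ x ∈ U, M ≤ σ * (2 * (x:ℝ) - ξ)) →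
        ∫ t in Set.Ioo A B, ‖∑ x ∈ U, c x * cexp (I * lam x * t)‖ ^ 2 ≤ G * K₁ * R * Q := by
      intro σ hσ U hU hUM
      refine (gauss_sieve U lam c (K₁ * R) hR' A B hABR ?_).trans ?_
      · intro x hx y hy
        have h := H N hhigh M (by linarith) ξ hξ σ hσ x y (hS x (hU hx)).1 (hS y (hU hy)).1
          (hUM x hx) (hUM y hy)
        have h' := mul_le_mul_of_nonneg_left h hR'.le
        refine le_trans ?_ h'
        have e : K₁ * R * (c₀ / 8 * N ^ (α - 1) * M * |(x:ℝ) - y|)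
          = K₁ * (c₀ / 8) * (N ^ (α - 1) * M * R) * |(x:ℝ) - y| := by ring
        rw [e, hNMR, mul_one]
        gcongr
      · rw [← hG, ← mul_assoc]
        gcongr
        exact hQle U hU
    have hI1 := hsep 1 (Or.inl rfl) S1 sub1 (fun x hx => (Finset.mem_filter.1 hx).2)
    have hI2 := hsep (-1) (Or.inr rfl) S2 sub2 (fun x hx => (Finset.mem_filter.1 hx).2)
    have hI3 : ∫ t in Set.Ioo A B, ‖∑ x ∈ S3, c x * cexp (I * lam x * t)‖ ^ 2 ≤ 2 * R * Q := by
      refine (card_sieve S3 lam c A B L hL hAB).trans ?_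
      have hcard : (S3.card : ℝ) ≤ 2 * M := by
        have := card_le_of_bdd S3 ((ξ - M)/2) ((ξ + M)/2) (by linarith) (fun x hx => by
          obtain ⟨h1, h2⟩ := Finset.mem_filter.1 hx
          have h3 := (Finset.mem_filter.1 h1).2
          constructor <;> linarith)
        linarith
      calc L * (S3.card * ∑ x ∈ S3, ‖c x‖^2) ≤ L * (2 * M * Q) := by
            gcongr
            exact hQle S3 sub3
        _ = 2 * (L * M) * Q := by ring
        _ ≤ _ := by gcongr
    have hin : ∀ U : Finset ℤ, IntegrableOn
        (fun t : ℝ => ‖∑ x ∈ U, c x * cexp (I * lam x * t)‖ ^ 2) (Set.Ioo A B) := by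
      intro U
      have : Continuous (fun t : ℝ => ‖∑ x ∈ U, c x * cexp (I * lam x * t)‖ ^ 2) := by fun_prop
      exact (this.integrableOn_Icc).mono_set Ioo_subset_Icc_self
    calc ∫ t in Set.Ioo A B, ‖∑ x ∈ S, c x * cexp (I * (lam x : ℝ) * t)‖ ^ 2
        ≤ ∫ t in Set.Ioo A B, 3 * (‖∑ x ∈ S1, c x * cexp (I * lam x * t)‖ ^ 2
            + (‖∑ x ∈ S2, c x * cexp (I * lam x * t)‖ ^ 2
            + ‖∑ x ∈ S3, c x * cexp (I * lam x * t)‖ ^ 2)) := by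
          refine setIntegral_mono_on (hin S)
            (((hin S1).add ((hin S2).add (hin S3))).const_mul 3) measurableSet_Ioo fun t _ => ?_
          rw [hsplit]
          set z1 := ∑ x ∈ S1, c x * cexp (I * lam x * t)
          set z2 := ∑ x ∈ S2, c x * cexp (I * lam x * t)
          set z3 := ∑ x ∈ S3, c x * cexp (I * lam x * t)
          have h1 : ‖z1 + (z2 + z3)‖ ≤ ‖z1‖ + (‖z2‖ + ‖z3‖) :=
            (norm_add_le _ _).trans (by gcongr; exact norm_add_le _ _)
          have h2 := pow_le_pow_left₀ (norm_nonneg _) h1 2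
          nlinarith [sq_nonneg (‖z1‖ - ‖z2‖), sq_nonneg (‖z1‖ - ‖z3‖), sq_nonneg (‖z2‖ - ‖z3‖)]
      _ = 3 * ((∫ t in Set.Ioo A B, ‖∑ x ∈ S1, c x * cexp (I * lam x * t)‖ ^ 2)
            + ((∫ t in Set.Ioo A B, ‖∑ x ∈ S2, c x * cexp (I * lam x * t)‖ ^ 2)
            + ∫ t in Set.Ioo A B, ‖∑ x ∈ S3, c x * cexp (I * lam x * t)‖ ^ 2)) := by
          rw [integral_const_mul, ← integral_add (hin S2) (hin S3)]
          congr 1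
          exact integral_add (hin S1) ((hin S2).add (hin S3))
      _ ≤ 3 * (G * K₁ * R * Q + (G * K₁ * R * Q + 2 * R * Q)) := by gcongr
      _ = 3 * (2 + 2 * (G * K₁)) * R * Q := by ring
      _ ≤ _ := by gcongr; exact le_max_right _ _

lemma PN_supp {χ : ℝ → ℝ} (hχ : CutoffFun χ) (n : ℕ) (φ : ℤ → ℂ) (x : ℤ)
    (hx : PN χ ((2:ℝ) ^ n) φ x ≠ 0) : (2:ℝ)^n / 2 ≤ |(x:ℝ)| ∧ |(x:ℝ)| ≤ 2 * 2^n := by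
  have h0 : (0:ℝ) < 2 ^ n := by positivity
  have h1 : lpSymb χ ((2:ℝ)^n) x ≠ 0 := by
    intro h; apply hx; simp [PN, h]
  rw [lpSymb, if_neg h0.ne'] at h1
  constructor
  · by_contra! hlt
    apply h1
    have a1 : |(x:ℝ) / 2^n| ≤ 1 := by
      rw [abs_div, abs_of_pos h0, div_le_one h0]; linarith
    have a2 : |2 * (x:ℝ) / 2^n| ≤ 1 := by
      rw [abs_div, abs_of_pos h0, div_le_one h0, abs_mul, abs_two]; linarith
    rw [hχ.eq_one _ (abs_le.1 a1), hχ.eq_one _ (abs_le.1 a2), sub_self]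
  · by_contra! hlt
    apply h1
    have a1 : χ ((x:ℝ) / 2^n) = 0 := by
      by_contra h
      have := abs_le.2 (hχ.compact_supp _ h)
      rw [abs_div, abs_of_pos h0, div_le_iff₀ h0] at this
      linarith
    have a2 : χ (2 * (x:ℝ) / 2^n) = 0 := by
      by_contra h
      have := abs_le.2 (hχ.compact_supp _ h)
      rw [abs_div, abs_of_pos h0, div_le_iff₀ h0, abs_mul, abs_two] at this
      have := abs_nonneg (x:ℝ)
      linarith
    rw [a1, a2, sub_self]

lemma total_bound {α K : ℝ} {p : ℝ → ℝ}
    (H : ∀ N M R L : ℝ, 1 ≤ N → 1 ≤ M → 0 < R → 0 ≤ L →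
      N ^ (α - 1) * M * R = 1 → L * M ≤ R →
      ∀ A B : ℝ, B - A ≤ L → ∀ ξ : ℤ, M ≤ |(ξ:ℝ)| → ∀ S : Finset ℤ,
      (∀ x ∈ S, N / 2 ≤ max |(x:ℝ)| |(ξ:ℝ) - x| ∧ |(x:ℝ)| ≤ 2 * N) → ∀ c : ℤ → ℂ,
      ∫ t in Set.Ioo A B, ‖∑ x ∈ S, c x * cexp (I * (p x + p (ξ - x) : ℝ) * t)‖ ^ 2
        ≤ K * R * ∑ x ∈ S, ‖c x‖ ^ 2)
    (hK : 0 < K)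
    (T : ℝ) (hT : 0 < T) (hT1 : T ≤ 1) (hα : α ∈ Set.Icc (1:ℝ) 2) (N : ℝ) (hN1 : 1 ≤ N)
    (a : ℝ → ℝ → ℂ) (ha : ∀ x y : ℝ, ‖a x y‖ ≤ 1) (u v : ℤ → ℂ) {N₁ N₂ : ℝ}
    (hu : ∀ x, u x ≠ 0 → N₁ / 2 ≤ |(x:ℝ)| ∧ |(x:ℝ)| ≤ 2 * N)
    (hv : ∀ x, v x ≠ 0 → N₂ / 2 ≤ |(x:ℝ)| ∧ |(x:ℝ)| ≤ 2 * N)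
    (hN : N = max N₁ N₂) (A B : ℝ) (hAB : B - A ≤ N⁻¹ * T) :
    ∫ t in Set.Ioo A B, l2sq (Lam a (freeEvol p u t) (freeEvol p v t))
      ≤ (K + 3) * (T ^ ((1:ℝ)/2) * N ^ (-(α/2))) * (l2sq u * l2sq v) := by
  have hN0 : 0 < N := by linarith
  set M : ℝ := N ^ (1 - α/2) * T ^ (-((1:ℝ)/2)) with hM
  set R : ℝ := T ^ ((1:ℝ)/2) * N ^ (-(α/2)) with hR
  have hR0 : 0 < R := by positivity
  have hM1 : 1 ≤ M := by
    have h1 : 1 ≤ N ^ (1 - α/2) := Real.one_le_rpow hN1 (by linarith [hα.2])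
    have h2 : 1 ≤ T ^ (-((1:ℝ)/2)) :=
      Real.one_le_rpow_of_pos_of_le_one_of_nonpos hT hT1 (by norm_num)
    exact one_le_mul_of_one_le_of_one_le h1 h2
  have hNMR : N ^ (α - 1) * M * R = 1 := by
    have e1 : N ^ (α - 1) * N ^ (1 - α/2) * N ^ (-(α/2)) = 1 := by
      rw [← Real.rpow_add hN0, ← Real.rpow_add hN0]; ring_nf; simp
    have e2 : T ^ (-((1:ℝ)/2)) * T ^ ((1:ℝ)/2) = 1 := by
      rw [← Real.rpow_add hT]; norm_num
    calc N ^ (α - 1) * M * R = (N ^ (α - 1) * N ^ (1 - α/2) * N ^ (-(α/2))) *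
          (T ^ (-((1:ℝ)/2)) * T ^ ((1:ℝ)/2)) := by rw [hM, hR]; ring
      _ = 1 := by rw [e1, e2, one_mul]
  have hLM : N⁻¹ * T * M = R := by
    have e1 : N⁻¹ * N ^ (1 - α/2) = N ^ (-(α/2)) := by
      rw [← Real.rpow_neg_one, ← Real.rpow_add hN0]; ring_nf
    have e2 : T * T ^ (-((1:ℝ)/2)) = T ^ ((1:ℝ)/2) := by
      nth_rewrite 1 [← Real.rpow_one T]
      rw [← Real.rpow_add hT]; norm_num
    rw [hM, hR, ← e1, ← e2]; ring
  have hL0 : 0 ≤ N⁻¹ * T := by positivity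
  -- finite supports
  set m : ℤ := ⌈2 * N⌉ with hm
  set F : Finset ℤ := Finset.Icc (-m) m with hF
  set G : Finset ℤ := Finset.Icc (-(m + m)) (m + m) with hG
  have hmem : ∀ x : ℤ, |(x:ℝ)| ≤ 2 * N → x ∈ F := by
    intro x hx
    have h1 : |(x:ℝ)| ≤ m := hx.trans (Int.le_ceil _)
    have h2 : |x| ≤ m := by exact_mod_cast h1
    exact Finset.mem_Icc.2 (abs_le.1 h2)
  have huF : ∀ x, x ∉ F → u x = 0 := fun x hx => by
    by_contra h; exact hx (hmem x (hu x h).2)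
  have hvF : ∀ x, x ∉ F → v x = 0 := fun x hx => by
    by_contra h; exact hx (hmem x (hv x h).2)
  have hul : ∑ x ∈ F, ‖u x‖^2 = l2sq u :=
    (tsum_eq_sum (fun x hx => by rw [huF x hx]; simp)).symm
  have hvs : Summable fun x => ‖v x‖^2 :=
    summable_of_ne_finset_zero (s := F) (fun x hx => by rw [hvF x hx]; simp)
  have hu0 : 0 ≤ l2sq u := tsum_nonneg fun _ => by positivity
  have hv0 : 0 ≤ l2sq v := tsum_nonneg fun _ => by positivity
  have hvl1 : ∀ (S : Finset ℤ) (ξ : ℤ), ∑ x ∈ S, ‖v (ξ - x)‖^2 ≤ l2sq v := by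
    intro S ξ
    rw [l2sq, ← (Equiv.subLeft ξ).tsum_eq]
    exact (((Equiv.subLeft ξ).summable_iff (f := fun x => ‖v x‖^2)).2 hvs).sum_le_tsum S
        (fun _ _ => by positivity)
  have hvl2 : ∀ (S : Finset ℤ) (x : ℤ), ∑ ξ ∈ S, ‖v (ξ - x)‖^2 ≤ l2sq v := by
    intro S x
    rw [l2sq, ← (Equiv.subRight x).tsum_eq]
    exact (((Equiv.subRight x).summable_iff (f := fun x => ‖v x‖^2)).2 hvs).sum_le_tsum S
        (fun _ _ => by positivity)
  set c : ℤ → ℤ → ℂ := fun ξ x => a x ((ξ:ℝ) - x) * u x * v (ξ - x) with hc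
  set S : ℤ → Finset ℤ := fun ξ => F.filter (fun x => c ξ x ≠ 0) with hS
  have hcle : ∀ ξ x, ‖c ξ x‖ ≤ ‖u x‖ * ‖v (ξ - x)‖ := by
    intro ξ x
    simp only [hc, norm_mul]
    have := ha x ((ξ:ℝ) - x)
    calc _ ≤ 1 * ‖u x‖ * ‖v (ξ - x)‖ := by gcongr
      _ = _ := by ring
  have hLam : ∀ t ξ, Lam a (freeEvol p u t) (freeEvol p v t) ξ
      = ∑ x ∈ S ξ, c ξ x * cexp (I * (p x + p (ξ - x) : ℝ) * t) := by
    intro t ξ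
    have e : ∀ x : ℤ, a x ((ξ:ℝ) - x) * freeEvol p u t x * freeEvol p v t (ξ - x)
        = c ξ x * cexp (I * (p x + p (ξ - x) : ℝ) * t) := by
      intro x
      simp only [freeEvol, hc]
      have : cexp (I * (p x + p (ξ - x) : ℝ) * t)
          = cexp (I * (p x) * t) * cexp (I * (p ((ξ - x : ℤ):ℝ)) * t) := by
        rw [← Complex.exp_add]; push_cast; congr 1; ring
      rw [this]; ring
    rw [Lam, tsum_congr e]
    refine tsum_eq_sum fun x hx => ?_
    have : c ξ x = 0 := by
      by_contra h
      refine hx (Finset.mem_filter.2 ⟨?_, h⟩)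
      by_contra h'
      exact h (by simp [hc, huF x h'])
    rw [this, zero_mul]
  have hl2 : ∀ t, l2sq (Lam a (freeEvol p u t) (freeEvol p v t))
      = ∑ ξ ∈ G, ‖∑ x ∈ S ξ, c ξ x * cexp (I * (p x + p (ξ - x) : ℝ) * t)‖^2 := by
    intro t
    rw [l2sq]
    simp_rw [hLam]
    refine tsum_eq_sum fun ξ hξ => ?_
    have : S ξ = ∅ := by
      refine Finset.filter_eq_empty_iff.2 fun x hx h => ?_
      apply h
      have : ξ - x ∉ F := by
        intro h'
        rw [hF, Finset.mem_Icc] at hx h'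
        exact hξ (Finset.mem_Icc.2 ⟨by linarith, by linarith⟩)
      simp [hc, hvF _ this]
    rw [this]; simp
  simp_rw [hl2]
  have hcontξ : ∀ ξ : ℤ, Continuous
      (fun t : ℝ => ‖∑ x ∈ S ξ, c ξ x * cexp (I * (p x + p (ξ - x) : ℝ) * t)‖^2) := by
    intro ξ; fun_prop
  rw [integral_finsetSum _ (fun ξ _ =>
    ((hcontξ ξ).integrableOn_Icc (a := A) (b := B)).mono_set Ioo_subset_Icc_self)]
  have hξb : ∀ ξ ∈ G, ∫ t in Set.Ioo A B,
      ‖∑ x ∈ S ξ, c ξ x * cexp (I * (p x + p (ξ - x) : ℝ) * t)‖^2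
      ≤ K * R * ∑ x ∈ F, ‖u x‖^2 * ‖v (ξ - x)‖^2
        + (if |(ξ:ℝ)| ≤ M then N⁻¹ * T * (l2sq u * l2sq v) else 0) := by
    intro ξ _
    split_ifs with hξ
    · refine le_trans (setInt_le _ (hcontξ ξ) A B (N⁻¹ * T) (l2sq u * l2sq v) hL0 hAB
        (by positivity) fun t => ?_) (le_add_of_nonneg_left (by positivity))
      have h1 := norm_expsum_le (S ξ) (fun x => p x + p (ξ - x)) (c ξ) t
      have h2 : ∑ x ∈ S ξ, ‖c ξ x‖ ≤ ∑ x ∈ F, ‖u x‖ * ‖v (ξ - x)‖ :=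
        (Finset.sum_le_sum_of_subset_of_nonneg (Finset.filter_subset _ _)
          (fun _ _ _ => norm_nonneg _)).trans (Finset.sum_le_sum fun x _ => hcle ξ x)
      refine (pow_le_pow_left₀ (norm_nonneg _) (h1.trans h2) 2).trans ?_
      refine (Finset.sum_mul_sq_le_sq_mul_sq _ _ _).trans ?_
      rw [hul]
      gcongr
      exact hvl1 F ξ
    · rw [add_zero]
      refine (H N M R (N⁻¹ * T) hN1 hM1 hR0 hL0 hNMR hLM.le A B hAB ξ (le_of_not_ge hξ) (S ξ)
        ?_ (c ξ)).trans ?_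
      · intro x hx
        have hcx := (Finset.mem_filter.1 hx).2
        have hux : u x ≠ 0 := fun h => hcx (by simp [hc, h])
        have hvx : v (ξ - x) ≠ 0 := fun h => hcx (by simp [hc, h])
        refine ⟨?_, (hu x hux).2⟩
        have h1 := (hu x hux).1
        have h2 := (hv _ hvx).1
        push_cast at h2
        rcases max_choice N₁ N₂ with h | h
        · rw [hN, h]; exact h1.trans (le_max_left _ _)
        · rw [hN, h]; exact h2.trans (le_max_right _ _)
      · gcongr
        refine (Finset.sum_le_sum_of_subset_of_nonneg (Finset.filter_subset _ _)
          (fun _ _ _ => by positivity)).trans (Finset.sum_le_sum fun x _ => ?_)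
        rw [← mul_pow]
        exact pow_le_pow_left₀ (norm_nonneg _) (hcle ξ x) 2
  refine (Finset.sum_le_sum hξb).trans ?_
  rw [Finset.sum_add_distrib, ← Finset.mul_sum, Finset.sum_comm]
  have hA : ∑ x ∈ F, ∑ ξ ∈ G, ‖u x‖^2 * ‖v (ξ - x)‖^2 ≤ l2sq u * l2sq v := by
    rw [← hul, Finset.sum_mul]
    refine Finset.sum_le_sum fun x _ => ?_
    rw [← Finset.mul_sum]
    gcongr
    exact hvl2 G x
  have hB : ∑ ξ ∈ G, (if |(ξ:ℝ)| ≤ M then N⁻¹ * T * (l2sq u * l2sq v) else 0)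
      ≤ 3 * R * (l2sq u * l2sq v) := by
    rw [← Finset.sum_filter, Finset.sum_const, nsmul_eq_mul]
    have hcard : ((G.filter (fun ξ : ℤ => |(ξ:ℝ)| ≤ M)).card : ℝ) ≤ 3 * M := by
      have := card_le_of_bdd (G.filter (fun ξ : ℤ => |(ξ:ℝ)| ≤ M)) (-M) M (by linarith)
        (fun x hx => abs_le.1 (Finset.mem_filter.1 hx).2)
      linarith
    calc _ ≤ 3 * M * (N⁻¹ * T * (l2sq u * l2sq v)) := by gcongr
      _ = 3 * (N⁻¹ * T * M) * (l2sq u * l2sq v) := by ring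
      _ = _ := by rw [hLM]
  calc _ ≤ K * R * (l2sq u * l2sq v) + 3 * R * (l2sq u * l2sq v) := by gcongr
    _ = _ := by ring

/-- Corollary `cor_free`, estimate (cor1):
bilinear estimate for free solutions: for any interval `I = ]A,B[` with
`|I| ≤ (N₁∨N₂)^{-1}T`,
`‖Λ_a(e^{-tL}P_{N₁}φ₁, e^{-tL}P_{N₂}φ₂)‖_{L²(I;L²)}
  ≤ C T^{1/4}(N₁∨N₂)^{-α/4}‖P_{N₁}φ₁‖_{L²}‖P_{N₂}φ₂‖_{L²}`. -/
theorem free_bilinear_I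
    (α ξ₀ c₀ C₀ : ℝ) (hα : α ∈ Set.Icc (1:ℝ) 2)
    (p : ℝ → ℝ) (hp : Hyp1 α ξ₀ c₀ C₀ p)
    (χ : ℝ → ℝ) (hχ : CutoffFun χ) :
    ∃ C : ℝ, 0 < C ∧
      ∀ (T : ℝ), 0 < T → T < 1 →
      ∀ (n₁ n₂ : ℕ),
      ∀ (a : ℝ → ℝ → ℂ), (∀ x y : ℝ, ‖a x y‖ ≤ 1) →
      ∀ (φ₁ φ₂ : ℤ → ℂ),
        (Summable fun ξ : ℤ => ‖φ₁ ξ‖ ^ 2) → (Summable fun ξ : ℤ => ‖φ₂ ξ‖ ^ 2) →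
      ∀ (A B : ℝ), B - A ≤ (max ((2:ℝ) ^ n₁) ((2:ℝ) ^ n₂))⁻¹ * T →
        L2normOn (Set.Ioo A B)
            (fun t => Lam a (PN χ ((2:ℝ) ^ n₁) (freeEvol p φ₁ t))
              (PN χ ((2:ℝ) ^ n₂) (freeEvol p φ₂ t))) ≤
          C * T ^ ((1:ℝ)/4) * (max ((2:ℝ) ^ n₁) ((2:ℝ) ^ n₂)) ^ (-(α/4)) *
            (l2sq (PN χ ((2:ℝ) ^ n₁) φ₁)) ^ ((1:ℝ)/2) *
            (l2sq (PN χ ((2:ℝ) ^ n₂) φ₂)) ^ ((1:ℝ)/2) := by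
  obtain ⟨K, hK, H⟩ := per_xi hα hp
  refine ⟨√(K + 3), Real.sqrt_pos.2 (by linarith), ?_⟩
  intro T hT hT1 n₁ n₂ a ha φ₁ φ₂ _ _ A B hAB
  set N : ℝ := max ((2:ℝ) ^ n₁) ((2:ℝ) ^ n₂) with hN
  have hN1 : 1 ≤ N := (one_le_pow₀ (by norm_num)).trans (le_max_left _ _)
  have hN0 : 0 < N := by linarith
  set u := PN χ ((2:ℝ) ^ n₁) φ₁ with hu
  set v := PN χ ((2:ℝ) ^ n₂) φ₂ with hv
  have hmain := total_bound H hK T hT hT1.le hα N hN1 a ha u v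
    (fun x hx => ⟨(PN_supp hχ n₁ φ₁ x hx).1, (PN_supp hχ n₁ φ₁ x hx).2.trans
      (by gcongr; exact le_max_left _ _)⟩)
    (fun x hx => ⟨(PN_supp hχ n₂ φ₂ x hx).1, (PN_supp hχ n₂ φ₂ x hx).2.trans
      (by gcongr; exact le_max_right _ _)⟩) hN A B hAB
  have hU : (fun t => Lam a (PN χ ((2:ℝ) ^ n₁) (freeEvol p φ₁ t))
              (PN χ ((2:ℝ) ^ n₂) (freeEvol p φ₂ t)))
      = fun t => Lam a (freeEvol p u t) (freeEvol p v t) := by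
    have e : ∀ n φ t, PN χ ((2:ℝ) ^ n) (freeEvol p φ t) = freeEvol p (PN χ ((2:ℝ) ^ n) φ) t := by
      intro n φ t
      funext x
      simp only [PN, freeEvol]
      ring
    funext t
    rw [e, e]
  rw [hU]
  unfold L2normOn
  have hu0 : 0 ≤ l2sq u := tsum_nonneg fun _ => by positivity
  have hv0 : 0 ≤ l2sq v := tsum_nonneg fun _ => by positivity
  calc _ ≤ ((K + 3) * (T ^ ((1:ℝ)/2) * N ^ (-(α/2))) * (l2sq u * l2sq v)) ^ ((1:ℝ)/2) := by
        refine Real.rpow_le_rpow ?_ hmain (by norm_num)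
        exact integral_nonneg fun t => tsum_nonneg fun _ => by positivity
    _ = _ := by
        rw [Real.mul_rpow (by positivity) (by positivity),
          Real.mul_rpow (by positivity) (by positivity),
          Real.mul_rpow (by positivity) (by positivity),
          Real.mul_rpow hu0 hv0, ← Real.rpow_mul hT.le, ← Real.rpow_mul hN0.le,
          Real.sqrt_eq_rpow]
        rw [show (1:ℝ)/2 * (1/2) = 1/4 by norm_num, show -(α/2) * (1/2) = -(α/4) by ring]
        ring

end
end
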